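/- arXiv:2009.14037 — 4 statements merged into one kernel-verified Lean document; each statement's English description precedes it below -/
import Mathlib

section
/- Let n ≥ 1 and let m be a positive integer. Then, as an identity of rational functions in ℚ(x_1^{1/2},…,x_n^{1/2}), the difference of the Schur polynomials s_{(m^n)} minus s_{(m^{n−1})}, both evaluated at the 2n−1 variables (x_1, x_1^{−1}, …, x_{n−1}, x_{n−1}^{−1}, x_n), equals sp_{((m/2−1)^n)}(x_1,…,x_n) · so^D_{((m/2+1)^{n−1})}(x_1,…,x_{n−1}) · x_n^{m/2}(x_n − x_n^{−1}). -/
open Matrix BigOperators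
open scoped Classical

noncomputable section

/-- The field `ℚ(t_1, …, t_n)` of rational functions in `n` indeterminates over `ℚ`. -/
abbrev FF (n : ℕ) : Type := FractionRing (MvPolynomial (Fin n) ℚ)

/-- The `i`-th indeterminate, viewed as an element of `FF n`. -/
def gen (n : ℕ) (i : Fin n) : FF n :=
  algebraMap (MvPolynomial (Fin n) ℚ) (FF n) (MvPolynomial.X i)

variable {F : Type*} [Field F]

/-- Symplectic character `sp_λ(x_1, …, x_N)`, in "doubled" form: `z i` represents
`x_i^{1/2}` and `μ i` represents `2·λ_i` (so half-integer weights are allowed). -/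
def spD {N : ℕ} (z : Fin N → F) (μ : Fin N → ℤ) : F :=
  Matrix.det (Matrix.of fun i j : Fin N =>
      z j ^ (μ i + 2 * ((N : ℤ) - (i : ℕ))) - z j ^ (-(μ i + 2 * ((N : ℤ) - (i : ℕ))))) /
  Matrix.det (Matrix.of fun i j : Fin N =>
      z j ^ (2 * ((N : ℤ) - (i : ℕ))) - z j ^ (-(2 * ((N : ℤ) - (i : ℕ)))))

/-- Odd orthogonal character `so^B_λ(x_1, …, x_N)`, in "doubled" form: `z i` represents
`x_i^{1/2}` and `μ i` represents `2·λ_i`. -/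
def soBD {N : ℕ} (z : Fin N → F) (μ : Fin N → ℤ) : F :=
  Matrix.det (Matrix.of fun i j : Fin N =>
      z j ^ (μ i + 2 * ((N : ℤ) - (i : ℕ)) - 1) -
        z j ^ (-(μ i + 2 * ((N : ℤ) - (i : ℕ)) - 1))) /
  Matrix.det (Matrix.of fun i j : Fin N =>
      z j ^ (2 * ((N : ℤ) - (i : ℕ)) - 1) - z j ^ (-(2 * ((N : ℤ) - (i : ℕ)) - 1)))

/-- Even orthogonal character `so^D_λ(x_1, …, x_N)`, in "doubled" form: `z i` represents
`x_i^{1/2}` and `μ i` represents `2·λ_i`; the factor is `2` if `λ_N > 0` and `1` otherwise. -/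
def soDD {N : ℕ} (z : Fin N → F) (μ : Fin N → ℤ) : F :=
  (if h : 0 < N then (if 0 < μ ⟨N - 1, Nat.sub_lt h Nat.one_pos⟩ then (2 : F) else 1) else 1) *
  (Matrix.det (Matrix.of fun i j : Fin N =>
      z j ^ (μ i + 2 * ((N : ℤ) - 1 - (i : ℕ))) +
        z j ^ (-(μ i + 2 * ((N : ℤ) - 1 - (i : ℕ))))) /
   Matrix.det (Matrix.of fun i j : Fin N =>
      z j ^ (2 * ((N : ℤ) - 1 - (i : ℕ))) + z j ^ (-(2 * ((N : ℤ) - 1 - (i : ℕ))))))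

/-- The matrix `Ā_λ` of the bialternant formula for the intermediate symplectic character
`sp^{(k, N-k)}`, in "doubled" form: `z i` represents `x_i^{1/2}`, `μ i` represents `2·λ_i`. -/
def interMatD {N : ℕ} (k : ℕ) (z : Fin N → F) (μ : Fin N → ℤ) : Matrix (Fin N) (Fin N) F :=
  Matrix.of fun i j : Fin N =>
    if (j : ℕ) < k then
      z j ^ (μ i + 2 * ((k : ℤ) - (i : ℕ))) /
          ∏ l ∈ Finset.univ.filter (fun l : Fin N => k ≤ (l : ℕ)), (1 - (z j ^ 2)⁻¹ * z l ^ 2) -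
        z j ^ (-(μ i + 2 * ((k : ℤ) - (i : ℕ)))) /
          ∏ l ∈ Finset.univ.filter (fun l : Fin N => k ≤ (l : ℕ)), (1 - z j ^ 2 * z l ^ 2)
    else z j ^ (μ i + 2 * ((N : ℤ) - 1 - (i : ℕ)))

/-- Intermediate symplectic character `sp^{(k, N-k)}_λ(x_1, …, x_k | x_{k+1}, …, x_N)`, in
"doubled" form: `z i` represents `x_i^{1/2}` and `μ i` represents `2·λ_i`. -/
def spInterD {N : ℕ} (k : ℕ) (z : Fin N → F) (μ : Fin N → ℤ) : F :=
  (interMatD k z μ).det / (interMatD k z fun _ => 0).det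

/-- Symplectic character `sp_λ(z_1, …, z_N)` for an integer weight `μ`. -/
def spP {N : ℕ} (z : Fin N → F) (μ : Fin N → ℤ) : F :=
  Matrix.det (Matrix.of fun i j : Fin N =>
      z j ^ (μ i + (N : ℤ) - (i : ℕ)) - z j ^ (-(μ i + (N : ℤ) - (i : ℕ)))) /
  Matrix.det (Matrix.of fun i j : Fin N =>
      z j ^ ((N : ℤ) - (i : ℕ)) - z j ^ (-((N : ℤ) - (i : ℕ))))

/-- The matrix `Ā_λ` of the bialternant formula for the intermediate symplectic character
`sp^{(k, N-k)}` with integer weight `μ`. -/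
def interMatP {N : ℕ} (k : ℕ) (z : Fin N → F) (μ : Fin N → ℤ) : Matrix (Fin N) (Fin N) F :=
  Matrix.of fun i j : Fin N =>
    if (j : ℕ) < k then
      z j ^ (μ i + (k : ℤ) - (i : ℕ)) /
          ∏ l ∈ Finset.univ.filter (fun l : Fin N => k ≤ (l : ℕ)), (1 - (z j)⁻¹ * z l) -
        z j ^ (-(μ i + (k : ℤ) - (i : ℕ))) /
          ∏ l ∈ Finset.univ.filter (fun l : Fin N => k ≤ (l : ℕ)), (1 - z j * z l)
    else z j ^ (μ i + (N : ℤ) - 1 - (i : ℕ))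

/-- Intermediate symplectic character `sp^{(k, N-k)}_μ(z_1, …, z_k | z_{k+1}, …, z_N)`
for an integer weight `μ`. -/
def spInterP {N : ℕ} (k : ℕ) (z : Fin N → F) (μ : Fin N → ℤ) : F :=
  (interMatP k z μ).det / (interMatP k z fun _ => 0).det

/-- Schur function `s_μ(z_1, …, z_N)` as a ratio of alternants (bialternant formula). -/
def schurP {N : ℕ} (z : Fin N → F) (μ : Fin N → ℤ) : F :=
  Matrix.det (Matrix.of fun i j : Fin N => z j ^ (μ i + (N : ℤ) - 1 - (i : ℕ))) /
  Matrix.det (Matrix.of fun i j : Fin N => z j ^ ((N : ℤ) - 1 - (i : ℕ)))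

/-- Block evaluation of a determinant whose two halves are exchanged, up to `ε = ±1`, by an
involution on rows and columns fixing the last row of `a`, `b`. -/
theorem det_fromBlocks_of_involution {p : ℕ} (ε : F) (hε : ε * ε = 1)
    (a b : Matrix (Fin (p + 1)) (Fin (p + 1)) F)
    (hab : ∀ j, b (Fin.last p) j = ε * a (Fin.last p) j) :
    (fromBlocks a (b.submatrix id Fin.castSucc) (b.submatrix Fin.castSucc id)
      (a.submatrix Fin.castSucc Fin.castSucc)).det =
    (of fun i j => if i = Fin.last p then a i j else a i j + ε * b i j).det *
      (of fun i j : Fin p => a i.castSucc j.castSucc - ε * b i.castSucc j.castSucc).det := by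
  set R : Matrix (Fin (p + 1)) (Fin p) F := of fun i k => if i = k.castSucc then ε else 0 with hR
  set C : Matrix (Fin (p + 1)) (Fin p) F := of fun j k => if j = k.castSucc then -ε else 0 with hC
  have hRmul : ∀ (X : Matrix (Fin (p + 1)) (Fin (p + 1)) F) (i j),
      (R * X.submatrix Fin.castSucc id) i j = if i = Fin.last p then 0 else ε * X i j := by
    intro X i j
    rw [Matrix.mul_apply]
    induction i using Fin.lastCases with
    | last => simp [hR, (Fin.castSucc_lt_last _).ne']
    | cast i => simp [hR, (Fin.castSucc_lt_last _).ne]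
  have hCmul : ∀ {q : ℕ} (X : Matrix (Fin q) (Fin (p + 1)) F) (i j),
      (X * C) i j = - ε * X i j.castSucc := by
    intro q X i j
    simp [Matrix.mul_apply, hC, mul_comm]
  have key : fromBlocks 1 R 0 1 *
      fromBlocks a (b.submatrix id Fin.castSucc) (b.submatrix Fin.castSucc id)
        (a.submatrix Fin.castSucc Fin.castSucc) * fromBlocks 1 C 0 1 =
      fromBlocks (of fun i j => if i = Fin.last p then a i j else a i j + ε * b i j) 0
        (b.submatrix Fin.castSucc id)
        (of fun i j : Fin p => a i.castSucc j.castSucc - ε * b i.castSucc j.castSucc) := by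
    have h1 : a + R * b.submatrix Fin.castSucc id =
        of fun i j => if i = Fin.last p then a i j else a i j + ε * b i j := by
      ext i j
      rw [Matrix.add_apply, hRmul, of_apply]
      split_ifs <;> simp
    have h2 : ∀ i (j : Fin p), (R * a.submatrix Fin.castSucc Fin.castSucc) i j =
        if i = Fin.last p then 0 else ε * a i j.castSucc := fun i j => hRmul a i j.castSucc
    simp only [fromBlocks_multiply, Matrix.one_mul, Matrix.mul_one, Matrix.zero_mul, zero_add,
      Matrix.mul_zero, add_zero, h1]
    congr 1
    · ext i j
      rw [Matrix.add_apply, Matrix.add_apply, hCmul, h2, of_apply, submatrix_apply]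
      by_cases h : i = Fin.last p
      · subst h
        simp [hab]
      · simp only [h, if_false, id, Matrix.zero_apply]
        linear_combination (-b i j.castSucc) * hε
    · ext i j
      rw [Matrix.add_apply, hCmul]
      simp only [submatrix_apply, id, of_apply]
      ring
  have := congrArg det key
  simpa [det_mul, det_fromBlocks_zero₂₁, det_fromBlocks_zero₁₂] using this

/-- The matrix of the Weyl denominator of type `D`, with the last row normalised to `1`. -/
def evenOrthDenMat {N : ℕ} (t : Fin N → F) : Matrix (Fin N) (Fin N) F :=
  Matrix.of fun i j : Fin N => if (i : ℕ) + 1 = N then 1 else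
    t j ^ (2 * ((N : ℤ) - 1 - (i : ℕ))) + t j ^ (-(2 * ((N : ℤ) - 1 - (i : ℕ))))

theorem det_sp_den_eq {N : ℕ} (t : Fin N → F) (ht : ∀ j, t j ≠ 0) :
    Matrix.det (Matrix.of fun i j : Fin N =>
      t j ^ (2 * ((N : ℤ) - (i : ℕ))) - t j ^ (-(2 * ((N : ℤ) - (i : ℕ))))) =
    (∏ j, (t j ^ 2 - (t j ^ 2)⁻¹)) * (evenOrthDenMat t).det := by
  set A : Matrix (Fin N) (Fin N) F := Matrix.of fun i j : Fin N =>
      t j ^ (2 * ((N : ℤ) - (i : ℕ))) - t j ^ (-(2 * ((N : ℤ) - (i : ℕ)))) with hA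
  set L : Matrix (Fin N) (Fin N) F := Matrix.of fun i j : Fin N =>
      if i = j then 1 else if (j : ℕ) = i + 2 then -1 else 0 with hL
  have hLdet : L.det = 1 := by
    rw [Matrix.det_of_isUpperTriangular]
    · simp [hL]
    · intro i j hij
      have hij : j < i := hij
      have h1 : i ≠ j := hij.ne'
      have h2 : (j : ℕ) ≠ i + 2 := by have : (j : ℕ) < i := hij; omega
      simp [hL, h1, h2]
  have hmul : L * A = Matrix.of fun i j => (t j ^ 2 - (t j ^ 2)⁻¹) * evenOrthDenMat t i j := by
    ext i j
    have hsum : (L * A) i j = A i j - if h : (i : ℕ) + 2 < N then A ⟨i + 2, h⟩ j else 0 := by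
      rw [Matrix.mul_apply]
      have h0 : ∀ k, L i k * A k j = (if i = k then A i j else 0) -
          (if (k : ℕ) = i + 2 then A k j else 0) := by
        intro k
        simp only [hL, Matrix.of_apply]
        by_cases h1 : i = k
        · subst h1; simp
        · simp only [h1, if_false]
          split_ifs <;> simp
      simp only [h0, Finset.sum_sub_distrib, Finset.sum_ite_eq, Finset.mem_univ, if_true]
      congr 1
      split_ifs with h
      · rw [Finset.sum_eq_single ⟨i + 2, h⟩]
        · simp
        · intro k _ hk
          rw [if_neg]
          exact fun h' => hk (Fin.ext h')
        · simp
      · refine Finset.sum_eq_zero fun k _ => if_neg ?_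
        have := k.isLt
        omega
    have htj := ht j
    rw [hsum]
    simp only [hA, Matrix.of_apply, evenOrthDenMat]
    obtain ⟨d, hd⟩ : ∃ d : ℕ, N = i + 1 + d := ⟨N - (i + 1), by have := i.isLt; omega⟩
    have hN : (N : ℤ) = (i : ℕ) + 1 + d := by exact_mod_cast hd
    have e1 : (2 * ((N : ℤ) - (i : ℕ))) = 2 * d + 2 := by rw [hN]; ring
    have e2 : (2 * ((N : ℤ) - 1 - (i : ℕ))) = 2 * d := by rw [hN]; ring
    have e3 : (2 * ((N : ℤ) - ((i : ℕ) + 2 : ℕ))) = 2 * d - 2 := by rw [hN]; push_cast; ring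
    rw [e1, e2, e3]
    have hz : (t j ^ 2 - (t j ^ 2)⁻¹) * (t j ^ (2 * (d : ℤ)) + t j ^ (-(2 * (d : ℤ)))) =
        t j ^ (2 * (d : ℤ) + 2) - t j ^ (-(2 * (d : ℤ) + 2)) -
          (t j ^ (2 * (d : ℤ) - 2) - t j ^ (-(2 * (d : ℤ) - 2))) := by
      have c1 : t j ^ 2 = t j ^ (2 : ℤ) := by norm_cast
      have c2 : (t j ^ 2)⁻¹ = t j ^ (-2 : ℤ) := by rw [_root_.zpow_neg]; norm_cast
      rw [c2, c1, sub_mul, mul_add, mul_add, ← zpow_add₀ htj, ← zpow_add₀ htj, ← zpow_add₀ htj,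
        ← zpow_add₀ htj]
      ring_nf
    rcases Nat.lt_or_ge 1 d with hd1 | hd1
    · rw [dif_pos (by omega), if_neg (by omega), hz]
    · rw [dif_neg (by omega)]
      interval_cases d
      · rw [if_pos (by omega)]
        simp [_root_.zpow_neg, zpow_ofNat]
      · rw [if_neg (by omega), hz]
        simp
  have := congrArg Matrix.det hmul
  rw [Matrix.det_mul, hLdet, one_mul, Matrix.det_mul_row] at this
  exact this

theorem det_evenOrth_den_eq {N : ℕ} (t : Fin N → F) :
    Matrix.det (Matrix.of fun i j : Fin N =>
      t j ^ (2 * ((N : ℤ) - 1 - (i : ℕ))) + t j ^ (-(2 * ((N : ℤ) - 1 - (i : ℕ))))) =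
    (if 0 < N then 2 else 1) * (evenOrthDenMat t).det := by
  have h : (Matrix.of fun i j : Fin N =>
      t j ^ (2 * ((N : ℤ) - 1 - (i : ℕ))) + t j ^ (-(2 * ((N : ℤ) - 1 - (i : ℕ))))) =
      Matrix.of fun i j : Fin N => (if (i : ℕ) + 1 = N then (2 : F) else 1) * evenOrthDenMat t i j := by
    ext i j
    simp only [Matrix.of_apply, evenOrthDenMat]
    split_ifs with h
    · have : (2 * ((N : ℤ) - 1 - (i : ℕ))) = 0 := by omega
      rw [this]; norm_num
    · rw [one_mul]
  rw [h, Matrix.det_mul_column]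
  congr 1
  cases N with
  | zero => simp
  | succ p =>
    rw [Fin.prod_univ_castSucc]
    have : ∀ i : Fin p, (i : ℕ) ≠ p := fun i => i.isLt.ne
    simp [this]

theorem exists_det_submatrix_equiv_eq {α β : Type*} [Fintype α] [DecidableEq α] [Fintype β]
    [DecidableEq β] (e f : α ≃ β) :
    ∃ s : F, s ≠ 0 ∧ ∀ M : Matrix β β F, (M.submatrix e f).det = s * M.det := by
  refine ⟨((Equiv.Perm.sign (f.symm.trans e) : ℤ) : F), ?_, fun M => ?_⟩
  · rcases Int.units_eq_one_or (Equiv.Perm.sign (f.symm.trans e)) with h | h <;> simp [h]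
  · rw [← Matrix.det_permute, ← Matrix.det_submatrix_equiv_self f]
    congr 1
    ext i j
    simp

/-- Row order putting `i` opposite to `2p - i`. -/
def rowEquiv (p : ℕ) : Fin (p + 1) ⊕ Fin p ≃ Fin (2 * (p + 1) - 1) :=
  Equiv.ofBijective
    (Sum.elim (fun i => ⟨i, by omega⟩) (fun i => ⟨2 * p - i, by omega⟩)) <| by
    rw [Fintype.bijective_iff_injective_and_card]
    refine ⟨?_, by simp; omega⟩
    rintro (i | i) (j | j) h <;> simp [Fin.ext_iff] at h ⊢ <;> omega

/-- Column order putting the even indices before the odd ones. -/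
def colEquiv (p : ℕ) : Fin (p + 1) ⊕ Fin p ≃ Fin (2 * (p + 1) - 1) :=
  Equiv.ofBijective
    (Sum.elim (fun i => ⟨2 * i, by omega⟩) (fun i => ⟨2 * i + 1, by omega⟩)) <| by
    rw [Fintype.bijective_iff_injective_and_card]
    refine ⟨?_, by simp; omega⟩
    rintro (i | i) (j | j) h <;> simp [Fin.ext_iff] at h ⊢ <;> omega

/-- The variables `(x_1, x_1⁻¹, …, x_p, x_p⁻¹, x_{p+1})` where `x_i = (t i)^2`. -/
def interleavedVars {p : ℕ} (t : Fin (p + 1) → F) (j : Fin (2 * (p + 1) - 1)) : F :=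
  if (j : ℕ) % 2 = 0 then t ⟨(j : ℕ) / 2, by have := j.isLt; omega⟩ ^ 2
    else (t ⟨(j : ℕ) / 2, by have := j.isLt; omega⟩ ^ 2)⁻¹

theorem interleavedVars_col_inl {p : ℕ} (t : Fin (p + 1) → F) (j : Fin (p + 1)) :
    interleavedVars t (colEquiv p (Sum.inl j)) = t j ^ (2 : ℤ) := by
  have : (colEquiv p (Sum.inl j) : ℕ) = 2 * j := rfl
  simp only [interleavedVars, this]
  simp [zpow_ofNat]

theorem interleavedVars_col_inr {p : ℕ} (t : Fin (p + 1) → F) (j : Fin p) :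
    interleavedVars t (colEquiv p (Sum.inr j)) = t j.castSucc ^ (-2 : ℤ) := by
  have : (colEquiv p (Sum.inr j) : ℕ) = 2 * j + 1 := rfl
  have h2 : (2 * (j : ℕ) + 1) / 2 = j := by omega
  simp only [interleavedVars, this, h2]
  rw [if_neg (by omega), _root_.zpow_neg]
  exact congrArg _ (zpow_ofNat _ 2).symm

/-- Factorization of an alternant in the variables `interleavedVars t` whose exponents (halved) are
symmetric about `M / 2 + p`, with middle row `g` even (`ε = 1`) or odd (`ε = -1`) under `x ↦ x⁻¹`,
into a determinant of size `p + 1` and one of size `p`. -/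
theorem det_interleaved_eq {p : ℕ} (t : Fin (p + 1) → F) (ht : ∀ j, t j ≠ 0) (M : ℤ) (ε : F)
    (hε : ε * ε = 1) (g : F → F) (hg : ∀ x, g x⁻¹ = ε * g x)
    (A : Matrix (Fin (2 * (p + 1) - 1)) (Fin (2 * (p + 1) - 1)) F) (s : F)
    (hs : (A.submatrix (rowEquiv p) (colEquiv p)).det = s * A.det)
    (hA : ∀ i j, ∀ y, y ≠ 0 → interleavedVars t j = y ^ (2 : ℤ) → A i j = y ^ (M + 2 * p) *
      if (i : ℕ) < p then y ^ (M + 2 * ((p : ℤ) - (i : ℕ))) else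
      if (i : ℕ) = p then g y else y ^ (-(M + 2 * ((i : ℤ) - p)))) :
    s * A.det = t (Fin.last p) ^ (M + 2 * p) *
      ((Matrix.of fun i j : Fin (p + 1) => if i = Fin.last p then g (t j) else
        t j ^ (M + 2 * ((p : ℤ) - (i : ℕ))) + ε * t j ^ (-(M + 2 * ((p : ℤ) - (i : ℕ))))).det *
      (Matrix.of fun i j : Fin p =>
        t j.castSucc ^ (M + 2 * ((p : ℤ) - (i : ℕ))) -
          ε * t j.castSucc ^ (-(M + 2 * ((p : ℤ) - (i : ℕ))))).det) := by
  set a : Matrix (Fin (p + 1)) (Fin (p + 1)) F := Matrix.of fun i j =>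
    if i = Fin.last p then g (t j) else t j ^ (M + 2 * ((p : ℤ) - (i : ℕ))) with ha
  set b : Matrix (Fin (p + 1)) (Fin (p + 1)) F := Matrix.of fun i j =>
    if i = Fin.last p then ε * g (t j) else t j ^ (-(M + 2 * ((p : ℤ) - (i : ℕ)))) with hb
  have key := det_fromBlocks_of_involution ε hε a b (by simp [ha, hb])
  have hv : A.submatrix (rowEquiv p) (colEquiv p) = Matrix.of fun i j =>
      (Sum.elim (fun j => t j ^ (M + 2 * p)) (fun j => (t (Fin.castSucc j) ^ (M + 2 * p))⁻¹) :
        Fin (p + 1) ⊕ Fin p → F) j *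
      Matrix.fromBlocks a (b.submatrix id Fin.castSucc) (b.submatrix Fin.castSucc id)
      (a.submatrix Fin.castSucc Fin.castSucc) i j := by
    have r1 : ∀ i, (rowEquiv p (Sum.inl i) : ℕ) = i := fun i => rfl
    have r2 : ∀ i, (rowEquiv p (Sum.inr i) : ℕ) = 2 * p - i := fun i => rfl
    have hlast : ∀ i : Fin (p + 1), i = Fin.last p ↔ ¬ (i : ℕ) < p := by
      intro i; rw [Fin.ext_iff, Fin.val_last]; omega
    have hlast' : ∀ i : Fin (p + 1), ¬ (i : ℕ) < p → (i : ℕ) = p := by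
      intro i; omega
    ext i j
    rw [Matrix.submatrix_apply, Matrix.of_apply]
    rcases j with j | j
    · rw [hA _ _ (t j) (ht j) (interleavedVars_col_inl t j)]
      rcases i with i | i
      · simp only [r1, Sum.elim_inl, Matrix.fromBlocks_apply₁₁, ha, Matrix.of_apply, hlast]
        by_cases h : (i : ℕ) < p <;> simp [h, hlast' i]
      · have hi := i.isLt
        rw [r2, if_neg (by omega), if_neg (by omega)]
        simp only [Sum.elim_inl, Matrix.fromBlocks_apply₂₁, hb, Matrix.of_apply, hlast,
          Matrix.submatrix_apply, Fin.val_castSucc, hi, not_true, if_false, id]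
        rw [show -(M + 2 * (((2 * p - i : ℕ) : ℤ) - p)) = -(M + 2 * ((p : ℤ) - (i : ℕ))) by omega]
    · rw [hA _ _ (t j.castSucc)⁻¹ (inv_ne_zero (ht _))
        (by rw [interleavedVars_col_inr, _root_.inv_zpow, _root_.zpow_neg])]
      rcases i with i | i
      · simp only [r1, Sum.elim_inr, Matrix.fromBlocks_apply₁₂, hb, Matrix.of_apply, hlast,
          Matrix.submatrix_apply, id, _root_.inv_zpow, _root_.zpow_neg]
        by_cases h : (i : ℕ) < p <;> simp [h, hlast' i, hg]
      · have hi := i.isLt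
        rw [r2, if_neg (by omega), if_neg (by omega)]
        simp only [Sum.elim_inr, Matrix.fromBlocks_apply₂₂, ha, Matrix.of_apply, hlast,
          Matrix.submatrix_apply, Fin.val_castSucc, hi, not_true, if_false, _root_.inv_zpow, _root_.zpow_neg,
          inv_inv]
        rw [show M + 2 * (((2 * p - i : ℕ) : ℤ) - p) = M + 2 * ((p : ℤ) - (i : ℕ)) by omega]
  rw [← hs, hv, Matrix.det_mul_row, key]
  congr 1
  · rw [Fintype.prod_sum_type, Fin.prod_univ_castSucc]
    simp only [Sum.elim_inl, Sum.elim_inr]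
    rw [mul_right_comm, ← Finset.prod_mul_distrib, Finset.prod_eq_one, one_mul]
    intro j _
    exact mul_inv_cancel₀ (zpow_ne_zero _ (ht _))
  · congr 2
    · ext i j
      simp only [ha, hb, Matrix.of_apply]
      split_ifs <;> rfl
    · ext i j
      simp only [ha, hb, Matrix.of_apply, (Fin.castSucc_lt_last i).ne, if_false, Fin.val_castSucc]

theorem schurP_rectangle_sub_eq {p : ℕ} (m : ℕ) (hm : 0 < m) (t : Fin (p + 1) → F)
    (h2 : (2 : F) ≠ 0) (ht : ∀ j, t j ≠ 0)
    (hlast : t (Fin.last p) ^ 2 - (t (Fin.last p) ^ 2)⁻¹ ≠ 0) :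
    schurP (interleavedVars t) (fun j => if (j : ℕ) < p + 1 then (m : ℤ) else 0) -
      schurP (interleavedVars t) (fun j => if (j : ℕ) < p then (m : ℤ) else 0) =
    spD t (fun _ => (m : ℤ) - 2) * soDD (fun i : Fin p => t i.castSucc) (fun _ => (m : ℤ) + 2) *
      (t (Fin.last p) ^ (m : ℤ) * (t (Fin.last p) ^ 2 - (t (Fin.last p) ^ 2)⁻¹)) := by
  obtain ⟨s, hs0, hs⟩ := exists_det_submatrix_equiv_eq (F := F) (rowEquiv p) (colEquiv p)
  have hcast : ((2 * (p + 1) - 1 : ℕ) : ℤ) = 2 * p + 1 := by omega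
  -- the Vandermonde denominator
  have hden := det_interleaved_eq t ht 0 1 (by ring) (fun _ => 1) (by simp)
    (Matrix.of fun i j : Fin (2 * (p + 1) - 1) =>
      interleavedVars t j ^ (((2 * (p + 1) - 1 : ℕ) : ℤ) - 1 - (i : ℕ))) s (hs _) (by
      intro i j y hy hj
      rw [Matrix.of_apply, hj, hcast, ← _root_.zpow_mul]
      split_ifs with h h'
      · rw [← zpow_add₀ hy]; congr 1; ring
      · rw [mul_one, h']; congr 1; ring
      · rw [← zpow_add₀ hy]; congr 1; ring)
  -- the difference of the numerators
  set row : (Fin (2 * (p + 1) - 1) → F) := fun j =>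
    interleavedVars t j ^ ((m : ℤ) + p) - interleavedVars t j ^ (p : ℤ) with hrow
  set B : Matrix (Fin (2 * (p + 1) - 1)) (Fin (2 * (p + 1) - 1)) F := Matrix.of fun i j =>
      interleavedVars t j ^ ((if (i : ℕ) < p + 1 then (m : ℤ) else 0) +
        ((2 * (p + 1) - 1 : ℕ) : ℤ) - 1 - (i : ℕ)) with hB
  set B' : Matrix (Fin (2 * (p + 1) - 1)) (Fin (2 * (p + 1) - 1)) F := Matrix.of fun i j =>
      interleavedVars t j ^ ((if (i : ℕ) < p then (m : ℤ) else 0) +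
        ((2 * (p + 1) - 1 : ℕ) : ℤ) - 1 - (i : ℕ)) with hB'
  set k : Fin (2 * (p + 1) - 1) := ⟨p, by omega⟩ with hk
  have hsub : B.det - B'.det = (B.updateRow k row).det := by
    have e1 : row = B k + (-1 : F) • B' k := by
      ext j
      simp only [hrow, hB, hB', hk, Pi.add_apply, Pi.smul_apply, Matrix.of_apply, hcast]
      simp only [lt_add_iff_pos_right, zero_lt_one, if_true, lt_irrefl, if_false, smul_eq_mul]
      ring_nf
    have e2 : B.updateRow k (B' k) = B' := by
      ext i j
      by_cases h : i = k
      · subst h; simp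
      · have h' : (i : ℕ) ≠ p := fun h' => h (Fin.ext h')
        rw [Matrix.updateRow_ne h]
        simp only [hB, hB', Matrix.of_apply]
        have : (i : ℕ) < p + 1 ↔ (i : ℕ) < p := by omega
        simp only [this]
    rw [e1, Matrix.det_updateRow_add, Matrix.det_updateRow_smul, Matrix.updateRow_eq_self, e2]
    ring
  have hnum := det_interleaved_eq t ht m (-1) (by ring) (fun y => y ^ (m : ℤ) - y ^ (-(m : ℤ)))
    (by intro x; simp) (B.updateRow k row) s (hs _) (by
      intro i j y hy hj
      by_cases h : i = k
      · subst h
        simp only [Matrix.updateRow_self, hrow, hj, hk, lt_irrefl, if_false, if_true, ← _root_.zpow_mul,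
          mul_sub, ← zpow_add₀ hy]
        ring_nf
      · have h' : (i : ℕ) ≠ p := fun h' => h (Fin.ext h')
        rw [Matrix.updateRow_ne h]
        simp only [hB, Matrix.of_apply, hj, hcast, ← _root_.zpow_mul, h', if_false]
        split_ifs <;> first | omega | (rw [← zpow_add₀ hy]; congr 1; ring))
  have hsp := det_sp_den_eq t ht
  have hsp' := det_sp_den_eq (fun j : Fin p => t j.castSucc) (fun j => ht _)
  have hso := det_evenOrth_den_eq (fun j : Fin p => t j.castSucc)
  have hH : (Matrix.of fun i j : Fin (p + 1) => if i = Fin.last p then (1 : F) else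
        t j ^ (0 + 2 * ((p : ℤ) - (i : ℕ))) + 1 * t j ^ (-(0 + 2 * ((p : ℤ) - (i : ℕ))))) =
      evenOrthDenMat t := by
    ext i j
    simp [evenOrthDenMat, Fin.ext_iff]
  have hG : (Matrix.of fun i j : Fin p => t j.castSucc ^ (0 + 2 * ((p : ℤ) - (i : ℕ))) -
      1 * t j.castSucc ^ (-(0 + 2 * ((p : ℤ) - (i : ℕ))))) =
      Matrix.of fun i j : Fin p =>
      t j.castSucc ^ (2 * ((p : ℤ) - (i : ℕ))) - t j.castSucc ^ (-(2 * ((p : ℤ) - (i : ℕ)))) := by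
    ext i j
    simp
  have hS : (Matrix.of fun i j : Fin (p + 1) =>
      t j ^ ((m : ℤ) - 2 + 2 * (((p + 1 : ℕ) : ℤ) - (i : ℕ))) -
        t j ^ (-((m : ℤ) - 2 + 2 * (((p + 1 : ℕ) : ℤ) - (i : ℕ))))) =
      Matrix.of fun i j : Fin (p + 1) => if i = Fin.last p then
          t j ^ (m : ℤ) - t j ^ (-(m : ℤ)) else
        t j ^ ((m : ℤ) + 2 * ((p : ℤ) - (i : ℕ))) +
          -1 * t j ^ (-((m : ℤ) + 2 * ((p : ℤ) - (i : ℕ)))) := by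
    ext i j
    have e : (m : ℤ) - 2 + 2 * (((p + 1 : ℕ) : ℤ) - (i : ℕ)) =
      (m : ℤ) + 2 * ((p : ℤ) - (i : ℕ)) := by push_cast; ring
    simp only [Matrix.of_apply, e]
    split_ifs with h
    · subst h; simp
    · ring
  have hO : (Matrix.of fun i j : Fin p =>
      t j.castSucc ^ ((m : ℤ) + 2 + 2 * ((p : ℤ) - 1 - (i : ℕ))) +
        t j.castSucc ^ (-((m : ℤ) + 2 + 2 * ((p : ℤ) - 1 - (i : ℕ))))) =
      Matrix.of fun i j : Fin p => t j.castSucc ^ ((m : ℤ) + 2 * ((p : ℤ) - (i : ℕ))) -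
          -1 * t j.castSucc ^ (-((m : ℤ) + 2 * ((p : ℤ) - (i : ℕ)))) := by
    ext i j
    have e : (m : ℤ) + 2 + 2 * ((p : ℤ) - 1 - (i : ℕ)) =
      (m : ℤ) + 2 * ((p : ℤ) - (i : ℕ)) := by ring
    simp only [Matrix.of_apply, e]
    ring
  rw [hH, hG, hsp'] at hden
  have hc : (if h : 0 < p then (if (0 : ℤ) < (m : ℤ) + 2 then (2 : F) else 1) else 1) =
      if 0 < p then 2 else 1 := by
    have : (0 : ℤ) < (m : ℤ) + 2 := by omega
    simp [this]
  have hc0 : (if 0 < p then (2 : F) else 1) ≠ 0 := by split_ifs <;> simp [h2]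
  simp only [schurP, spD, soDD]
  rw [hc, hS, hO, hsp, hso, Fin.prod_univ_castSucc, ← sub_div, hsub,
    ← mul_div_mul_left _ _ hs0, hnum, hden]
  have hL := ht (Fin.last p)
  generalize (if 0 < p then (2 : F) else 1) = c at *
  simp only [zpow_add₀ hL, zpow_zero, one_mul]
  generalize (Matrix.det (n := Fin (p + 1)) (Matrix.of _) : F) = X
  generalize (Matrix.det (n := Fin p) (Matrix.of _) : F) = Y
  generalize Matrix.det (evenOrthDenMat t) = U
  generalize Matrix.det (evenOrthDenMat fun j : Fin p => t j.castSucc) = V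
  generalize (∏ j : Fin p, (t j.castSucc ^ 2 - (t j.castSucc ^ 2)⁻¹)) = P
  generalize hlastEq : t (Fin.last p) ^ 2 - (t (Fin.last p) ^ 2)⁻¹ = l at *
  have hq : t (Fin.last p) ^ (2 * (p : ℤ)) ≠ 0 := zpow_ne_zero _ hL
  generalize t (Fin.last p) ^ (2 * (p : ℤ)) = q at *
  generalize t (Fin.last p) ^ (m : ℤ) = w at *
  simp only [div_eq_mul_inv, mul_inv]
  field_simp

theorem gen_ne_zero (n : ℕ) (i : Fin n) : gen n i ≠ 0 := by
  have h := (map_ne_zero_iff _ (IsFractionRing.injective (MvPolynomial (Fin n) ℚ) (FF n))).2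
    (MvPolynomial.X_ne_zero (R := ℚ) i)
  exact h

theorem gen_sq_sub_inv_ne_zero (n : ℕ) (i : Fin n) : gen n i ^ 2 - (gen n i ^ 2)⁻¹ ≠ 0 := by
  intro h
  have h0 := gen_ne_zero n i
  have h4 : gen n i ^ 4 = 1 := by
    field_simp at h
    linear_combination h
  have hX : (MvPolynomial.X i : MvPolynomial (Fin n) ℚ) ^ 4 = 1 := by
    apply IsFractionRing.injective (MvPolynomial (Fin n) ℚ) (FF n)
    rw [map_pow, map_one]
    exact h4
  have := congrArg (MvPolynomial.eval fun _ => (0 : ℚ)) hX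
  simp at this

/-- **Factorization.**  For `n ≥ 1` and a positive integer `m`, the difference of the Schur
functions of shapes `(m^n)` and `(m^{n-1})` in the `2n-1` variables
`(x_1, x_1^{-1}, …, x_{n-1}, x_{n-1}^{-1}, x_n)` equals
`sp_{((m/2-1)^n)}(x_1,…,x_n) · so^D_{((m/2+1)^{n-1})}(x_1,…,x_{n-1}) · x_n^{m/2}(x_n - x_n^{-1})`,
as an identity in `ℚ(x_1^{1/2}, …, x_n^{1/2})`.  Here `gen n i` plays the role of `x_i^{1/2}`
(so `x_i = (gen n i)^2`), and the weights of `spD` and `soDD` are doubled. -/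
theorem schur_rectangle_diff_factor_sp_soD' (n m : ℕ) (hn : 1 ≤ n) (hm : 0 < m) :
    schurP
      (fun j : Fin (2 * n - 1) =>
        if (j : ℕ) % 2 = 0 then gen n ⟨(j : ℕ) / 2, by have := j.isLt; omega⟩ ^ 2
        else (gen n ⟨(j : ℕ) / 2, by have := j.isLt; omega⟩ ^ 2)⁻¹)
      (fun j => if (j : ℕ) < n then (m : ℤ) else 0) -
    schurP
      (fun j : Fin (2 * n - 1) =>
        if (j : ℕ) % 2 = 0 then gen n ⟨(j : ℕ) / 2, by have := j.isLt; omega⟩ ^ 2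
        else (gen n ⟨(j : ℕ) / 2, by have := j.isLt; omega⟩ ^ 2)⁻¹)
      (fun j => if (j : ℕ) < n - 1 then (m : ℤ) else 0) =
    spD (gen n) (fun _ => (m : ℤ) - 2) *
      soDD (fun i : Fin (n - 1) => gen n ⟨(i : ℕ), by have := i.isLt; omega⟩)
        (fun _ => (m : ℤ) + 2) *
      (gen n ⟨n - 1, by omega⟩ ^ (m : ℤ) *
        (gen n ⟨n - 1, by omega⟩ ^ 2 - (gen n ⟨n - 1, by omega⟩ ^ 2)⁻¹)) := by
  obtain ⟨p, rfl⟩ : ∃ p, n = p + 1 := ⟨n - 1, by omega⟩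
  exact schurP_rectangle_sub_eq m hm (gen (p + 1)) two_ne_zero (gen_ne_zero _)
    (gen_sq_sub_inv_ne_zero _ _)
end
end

section
/- Let n ≥ 1 and let m be a positive integer. Then, as an identity of rational functions in ℚ(x_1^{1/2},…,x_n^{1/2}), the sum of the Schur polynomials s_{(m^n)} and s_{(m^{n−1})}, both evaluated at the 2n variables (x_1, x_1^{−1}, …, x_n, x_n^{−1}), equals so^D_{((m/2)^n)}(x_1,…,x_n) · sp_{((m/2)^n)}(x_1,…,x_n). -/
open Matrix BigOperators
open scoped Classical

noncomputable section

variable {F : Type*} [Field F]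

/-- The interleaving bijection sending the `j`-th left, resp. right, index to `2j`, resp.
`2j + 1`. -/
def interleaveEquiv (n : ℕ) : Fin n ⊕ Fin n ≃ Fin (2 * n) where
  toFun := Sum.elim (fun j => ⟨2 * (j : ℕ), by omega⟩) (fun j => ⟨2 * (j : ℕ) + 1, by omega⟩)
  invFun r := if (r : ℕ) % 2 = 0 then Sum.inl ⟨(r : ℕ) / 2, by omega⟩
    else Sum.inr ⟨(r : ℕ) / 2, by omega⟩
  left_inv := by
    rintro (j | j)
    · simp
    · have h : (2 * (j : ℕ) + 1) / 2 = j := by omega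
      simp [h]
  right_inv r := by
    rcases Nat.mod_two_eq_zero_or_one (r : ℕ) with h | h
    · simp only [h, if_true, Sum.elim_inl, Fin.ext_iff]
      omega
    · simp only [h, one_ne_zero, if_false, Sum.elim_inr, Fin.ext_iff]
      omega

/-- The bijection sending the `i`-th left, resp. right, index to `i`, resp. `2n - 1 - i`. -/
def reflectEquiv (n : ℕ) : Fin n ⊕ Fin n ≃ Fin (2 * n) where
  toFun := Sum.elim (fun i => ⟨(i : ℕ), by omega⟩) (fun i => ⟨2 * n - 1 - (i : ℕ), by omega⟩)
  invFun r := if h : (r : ℕ) < n then Sum.inl ⟨(r : ℕ), h⟩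
    else Sum.inr ⟨2 * n - 1 - (r : ℕ), by omega⟩
  left_inv := by
    rintro (i | i)
    · simp
    · have h : ¬ (2 * n - 1 - (i : ℕ) < n) := by omega
      refine (dif_neg h).trans (congrArg Sum.inr (Fin.ext ?_))
      simp only [Sum.elim_inr]
      omega
  right_inv r := by
    by_cases h : (r : ℕ) < n
    · simp [h]
    · simp only [h, dite_false, Sum.elim_inr, Fin.ext_iff]
      omega

/-- The alternant whose row `n - 1` is the sum of the corresponding rows of the alternants of
`(m^n)` and `(m^{n-1})` in `2n` variables, all other rows being common to both. -/
def rectSumMat (n m : ℕ) (w : Fin (2 * n) → F) : Matrix (Fin (2 * n)) (Fin (2 * n)) F :=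
  Matrix.of fun i j =>
    if (i : ℕ) = n - 1 then w j ^ ((m : ℤ) + n) + w j ^ (n : ℤ)
    else w j ^ ((if (i : ℕ) < n then (m : ℤ) else 0) + ((2 * n : ℕ) : ℤ) - 1 - (i : ℕ))

/-- The matrix in the numerator of the even orthogonal character of `((m/2)^n)`. -/
def evenMat {n : ℕ} (m : ℕ) (z : Fin n → F) : Matrix (Fin n) (Fin n) F :=
  Matrix.of fun i j => z j ^ ((m : ℤ) + 2 * ((n : ℤ) - 1 - (i : ℕ))) +
    z j ^ (-((m : ℤ) + 2 * ((n : ℤ) - 1 - (i : ℕ))))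

/-- The matrix in the numerator of the symplectic character of `((m/2)^n)`. -/
def oddMat {n : ℕ} (m : ℕ) (z : Fin n → F) : Matrix (Fin n) (Fin n) F :=
  Matrix.of fun i j => z j ^ ((m : ℤ) + 2 * ((n : ℤ) - (i : ℕ))) -
    z j ^ (-((m : ℤ) + 2 * ((n : ℤ) - (i : ℕ))))

/-- The sum of the alternants of `(m^n)` and `(m^{n-1})` in `2n` variables. -/
theorem det_rectangle_add_det_rectangle (n m : ℕ) (hn : 1 ≤ n) (w : Fin (2 * n) → F) :
    Matrix.det (Matrix.of fun i j : Fin (2 * n) =>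
      w j ^ ((if (i : ℕ) < n then (m : ℤ) else 0) + ((2 * n : ℕ) : ℤ) - 1 - (i : ℕ))) +
    Matrix.det (Matrix.of fun i j : Fin (2 * n) =>
      w j ^ ((if (i : ℕ) < n - 1 then (m : ℤ) else 0) + ((2 * n : ℕ) : ℤ) - 1 - (i : ℕ))) =
    (rectSumMat n m w).det := by
  let p : Fin (2 * n) := ⟨n - 1, by omega⟩
  have key := Matrix.det_updateRow_add (rectSumMat n m w) p
    (fun j => w j ^ ((m : ℤ) + n)) (fun j => w j ^ (n : ℤ))
  have h0 : (rectSumMat n m w).updateRow p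
      ((fun j => w j ^ ((m : ℤ) + n)) + fun j => w j ^ (n : ℤ)) = rectSumMat n m w := by
    ext i j
    by_cases hi : i = p
    · subst hi
      simp [rectSumMat, p]
    · simp [hi]
  rw [h0] at key
  rw [key]
  congr 2
  · ext i j
    by_cases hi : i = p
    · subst hi
      simp only [Matrix.of_apply, Matrix.updateRow_self, p]
      congr 1
      rw [if_pos (by omega)]
      omega
    · have hi' : (i : ℕ) ≠ n - 1 := fun h => hi (Fin.ext h)
      simp [hi, rectSumMat, hi']
  · ext i j
    by_cases hi : i = p
    · subst hi
      simp only [Matrix.of_apply, Matrix.updateRow_self, p]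
      congr 1
      rw [if_neg (by omega)]
      omega
    · have hi' : (i : ℕ) ≠ n - 1 := fun h => hi (Fin.ext h)
      have hlt : (i : ℕ) < n - 1 ↔ (i : ℕ) < n := by omega
      simp [hi, rectSumMat, hi', hlt]

/-- A block matrix with equal upper blocks has determinant `det C * det (E - D)`. -/
theorem det_fromBlocks_same_top {ι : Type*} [Fintype ι] [DecidableEq ι] (C D E : Matrix ι ι F) :
    (Matrix.fromBlocks C C D E).det = C.det * (E - D).det := by
  have h : Matrix.fromBlocks C C D E * Matrix.fromBlocks 1 (-1) 0 1 =
      Matrix.fromBlocks C 0 D (E - D) := by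
    simp [Matrix.fromBlocks_multiply, sub_eq_neg_add]
  simpa [Matrix.det_mul] using congrArg Matrix.det h

/-- After reordering, the alternant sum in the variables `z_j^{±2}` factors. -/
theorem det_rectSumMat_submatrix {n : ℕ} (m : ℕ) (z : Fin n → F) (hz : ∀ j, z j ≠ 0)
    (w : Fin (2 * n) → F) (hl : ∀ j, w (interleaveEquiv n (Sum.inl j)) = z j ^ 2)
    (hr : ∀ j, w (interleaveEquiv n (Sum.inr j)) = (z j ^ 2)⁻¹) :
    ((rectSumMat n m w).submatrix (reflectEquiv n) (interleaveEquiv n)).det =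
      (evenMat m z).det * (oddMat m z).det := by
  let N : Matrix (Fin n) (Fin n) F :=
    Matrix.of fun i k => if (k : ℕ) = (i : ℕ) + 1 then 1 else 0
  let d : Fin n → F := fun j => z j ^ ((m : ℤ) + 2 * n)
  let B : Matrix (Fin n) (Fin n) F :=
    Matrix.of fun i j => z j ^ ((m : ℤ) + 2 * ((n : ℤ) - (i : ℕ)))
  let B' : Matrix (Fin n) (Fin n) F :=
    Matrix.of fun i j => z j ^ (-((m : ℤ) + 2 * ((n : ℤ) - (i : ℕ))))
  let A : Matrix (Fin n) (Fin n) F := Matrix.of fun i j =>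
    if (i : ℕ) = n - 1 then z j ^ (m : ℤ) + z j ^ (-(m : ℤ))
    else z j ^ ((m : ℤ) + 2 * ((n : ℤ) - 1 - (i : ℕ)))
  let A' : Matrix (Fin n) (Fin n) F := Matrix.of fun i j =>
    if (i : ℕ) = n - 1 then z j ^ (m : ℤ) + z j ^ (-(m : ℤ))
    else z j ^ (-((m : ℤ) + 2 * ((n : ℤ) - 1 - (i : ℕ))))
  have hNmul (X : Matrix (Fin n) (Fin n) F) (i j : Fin n) :
      (N * X) i j = if h : (i : ℕ) + 1 < n then X ⟨(i : ℕ) + 1, h⟩ j else 0 := by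
    rw [Matrix.mul_apply]
    split_ifs with h
    · rw [Finset.sum_eq_single ⟨(i : ℕ) + 1, h⟩]
      · simp [N]
      · intro k _ hk
        have : (k : ℕ) ≠ (i : ℕ) + 1 := fun h' => hk (Fin.ext h')
        simp [N, this]
      · simp
    · refine Finset.sum_eq_zero fun k _ => ?_
      have : (k : ℕ) ≠ (i : ℕ) + 1 := by omega
      simp [N, this]
  have hAB : A + N * B' = evenMat m z := by
    ext i j
    rw [Matrix.add_apply, hNmul]
    simp only [A, B', evenMat, Matrix.of_apply]
    split_ifs with h1 h2 h2
    · omega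
    · rw [show (m : ℤ) + 2 * ((n : ℤ) - 1 - (i : ℕ)) = m by omega, add_zero]
    · push_cast
      ring_nf
    · omega
  have hAB' : A' + N * B = evenMat m z := by
    ext i j
    rw [Matrix.add_apply, hNmul]
    simp only [A', B, evenMat, Matrix.of_apply]
    split_ifs with h1 h2 h2
    · omega
    · rw [show (m : ℤ) + 2 * ((n : ℤ) - 1 - (i : ℕ)) = m by omega, add_zero]
    · push_cast
      ring_nf
    · omega
  have hsq (j : Fin n) (a b c : ℤ) (h : 2 * a + b = c) : (z j ^ 2) ^ a * z j ^ b = z j ^ c := by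
    rw [← h, zpow_add₀ (hz j), _root_.zpow_mul]
    norm_cast
  have hsq' (j : Fin n) (a b c : ℤ) (h : -(2 * a) + b = c) :
      ((z j ^ 2)⁻¹) ^ a * z j ^ b = z j ^ c := by
    rw [_root_.inv_zpow', hsq j _ _ c]
    omega
  have hscale : (rectSumMat n m w).submatrix (reflectEquiv n) (interleaveEquiv n) *
      Matrix.diagonal (Sum.elim (fun j => (d j)⁻¹) d) = Matrix.fromBlocks A A' B' B := by
    ext (i | i) (j | j)
    all_goals
      rw [Matrix.mul_diagonal]
      simp only [Matrix.submatrix_apply, rectSumMat, Matrix.of_apply, hl, hr, Sum.elim_inl,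
        Sum.elim_inr, Matrix.fromBlocks_apply₁₁, Matrix.fromBlocks_apply₁₂,
        Matrix.fromBlocks_apply₂₁, Matrix.fromBlocks_apply₂₂, A, A', B, B', d, ← _root_.zpow_neg]
    · have hi : ((reflectEquiv n (Sum.inl i) : Fin (2 * n)) : ℕ) = i := rfl
      rw [hi, if_pos i.isLt]
      split_ifs
      · rw [add_mul]
        exact congrArg₂ _ (hsq j _ _ _ (by ring)) (hsq j _ _ _ (by ring))
      · exact hsq j _ _ _ (by push_cast; ring)
    · have hi : ((reflectEquiv n (Sum.inl i) : Fin (2 * n)) : ℕ) = i := rfl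
      rw [hi, if_pos i.isLt]
      split_ifs
      · rw [add_mul, add_comm (z j ^ (m : ℤ))]
        exact congrArg₂ _ (hsq' j _ _ _ (by ring)) (hsq' j _ _ _ (by ring))
      · exact hsq' j _ _ _ (by push_cast; ring)
    · have hi : ((reflectEquiv n (Sum.inr i) : Fin (2 * n)) : ℕ) = 2 * n - 1 - i := rfl
      rw [hi, if_neg (by omega), if_neg (by omega)]
      exact hsq j _ _ _ (by omega)
    · have hi : ((reflectEquiv n (Sum.inr i) : Fin (2 * n)) : ℕ) = 2 * n - 1 - i := rfl
      rw [hi, if_neg (by omega), if_neg (by omega)]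
      exact hsq' j _ _ _ (by omega)
  have hdiag : (Matrix.diagonal (Sum.elim (fun j => (d j)⁻¹) d)).det = 1 := by
    have hd (j : Fin n) : (d j)⁻¹ * d j = 1 := inv_mul_cancel₀ (zpow_ne_zero _ (hz j))
    simp only [Matrix.det_diagonal, Fintype.prod_sum_type, Sum.elim_inl, Sum.elim_inr,
      ← Finset.prod_mul_distrib, hd, Finset.prod_const_one]
  have hrow : Matrix.fromBlocks 1 N 0 1 * Matrix.fromBlocks A A' B' B =
      Matrix.fromBlocks (evenMat m z) (evenMat m z) B' B := by
    simp [Matrix.fromBlocks_multiply, hAB, hAB']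
  have hBB : B - B' = oddMat m z := rfl
  calc ((rectSumMat n m w).submatrix (reflectEquiv n) (interleaveEquiv n)).det
      = (Matrix.fromBlocks A A' B' B).det := by rw [← hscale, Matrix.det_mul, hdiag, mul_one]
    _ = (Matrix.fromBlocks 1 N 0 1 * Matrix.fromBlocks A A' B' B).det := by
      rw [Matrix.det_mul, Matrix.det_fromBlocks_zero₂₁]
      simp
    _ = (evenMat m z).det * (oddMat m z).det := by rw [hrow, det_fromBlocks_same_top, hBB]

/-- The alternant sum in the variables `z_j^{±2}` factors up to a sign independent of `m`. -/
theorem sign_mul_det_rectSumMat {n : ℕ} (m : ℕ) (z : Fin n → F) (hz : ∀ j, z j ≠ 0)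
    (w : Fin (2 * n) → F) (hl : ∀ j, w (interleaveEquiv n (Sum.inl j)) = z j ^ 2)
    (hr : ∀ j, w (interleaveEquiv n (Sum.inr j)) = (z j ^ 2)⁻¹) :
    ((Equiv.Perm.sign ((reflectEquiv n).trans (interleaveEquiv n).symm) : ℤ) : F) *
      (rectSumMat n m w).det = (evenMat m z).det * (oddMat m z).det := by
  rw [← det_rectSumMat_submatrix m z hz w hl hr,
    ← Matrix.det_submatrix_equiv_self (interleaveEquiv n) (rectSumMat n m w),
    ← Matrix.det_permute, Matrix.submatrix_submatrix]
  congr 2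
  ext i
  simp

/-- **Factorization.**  For `n ≥ 1` and a positive integer `m`, the sum of the Schur functions
of shapes `(m^n)` and `(m^{n-1})` in the `2n` variables `(x_1, x_1^{-1}, …, x_n, x_n^{-1})`
equals `so^D_{((m/2)^n)}(x_1,…,x_n) · sp_{((m/2)^n)}(x_1,…,x_n)`, as an identity in
`ℚ(x_1^{1/2}, …, x_n^{1/2})`.  Here `gen n i` plays the role of `x_i^{1/2}` (so
`x_i = (gen n i)^2`), and the weights of `soDD` and `spD` are doubled. -/
theorem schur_rectangle_sum_factor_soD_sp (n m : ℕ) (hn : 1 ≤ n) (hm : 0 < m) :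
    schurP
      (fun j : Fin (2 * n) =>
        if (j : ℕ) % 2 = 0 then gen n ⟨(j : ℕ) / 2, by have := j.isLt; omega⟩ ^ 2
        else (gen n ⟨(j : ℕ) / 2, by have := j.isLt; omega⟩ ^ 2)⁻¹)
      (fun j => if (j : ℕ) < n then (m : ℤ) else 0) +
    schurP
      (fun j : Fin (2 * n) =>
        if (j : ℕ) % 2 = 0 then gen n ⟨(j : ℕ) / 2, by have := j.isLt; omega⟩ ^ 2
        else (gen n ⟨(j : ℕ) / 2, by have := j.isLt; omega⟩ ^ 2)⁻¹)
      (fun j => if (j : ℕ) < n - 1 then (m : ℤ) else 0) =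
    soDD (gen n) (fun _ => (m : ℤ)) * spD (gen n) (fun _ => (m : ℤ)) := by
  set w : Fin (2 * n) → FF n := fun j =>
    if (j : ℕ) % 2 = 0 then gen n ⟨(j : ℕ) / 2, by have := j.isLt; omega⟩ ^ 2
    else (gen n ⟨(j : ℕ) / 2, by have := j.isLt; omega⟩ ^ 2)⁻¹ with hw
  have hz (j : Fin n) : gen n j ≠ 0 := by
    simp [gen, MvPolynomial.X_ne_zero]
  have hl (j : Fin n) : w (interleaveEquiv n (Sum.inl j)) = gen n j ^ 2 := by
    simp [hw, interleaveEquiv]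
  have hr (j : Fin n) : w (interleaveEquiv n (Sum.inr j)) = (gen n j ^ 2)⁻¹ := by
    have h : (2 * (j : ℕ) + 1) / 2 = j := by omega
    simp [hw, interleaveEquiv, h]
  have hsm := sign_mul_det_rectSumMat m (gen n) hz w hl hr
  have hs0 := sign_mul_det_rectSumMat 0 (gen n) hz w hl hr
  have hm1 := det_rectangle_add_det_rectangle n m hn w
  have h01 := det_rectangle_add_det_rectangle n 0 hn w
  simp only [Nat.cast_zero, ite_self, zero_add] at h01
  rw [← two_mul] at h01
  rw [schurP, schurP, ← add_div, hm1]
  have hD : soDD (gen n) (fun _ => (m : ℤ)) =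
      2 * ((evenMat m (gen n)).det / (evenMat 0 (gen n)).det) := by
    have hn0 : 0 < n := hn
    simp [soDD, evenMat, hn0, hm]
  have hS : spD (gen n) (fun _ => (m : ℤ)) =
      (oddMat m (gen n)).det / (oddMat 0 (gen n)).det := by
    simp [spD, oddMat]
  have hsign : ((Equiv.Perm.sign ((reflectEquiv n).trans (interleaveEquiv n).symm) : ℤ) : FF n)
      ≠ 0 := by
    simp
  rw [hD, hS, mul_assoc, div_mul_div_comm, ← hsm, ← hs0, ← h01, mul_div_mul_left _ _ hsign,
    ← mul_div_assoc, mul_div_mul_left _ _ two_ne_zero]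
end
end

section
/- Let 0 < k ≤ n be integers, let m be a nonnegative integer, and let λ = (λ_1,…,λ_n) be a partition with λ_1 ≤ m. Then, viewing the intermediate symplectic character sp^{(k,n−k)}_λ(x_1,…,x_k | x_{k+1},…,x_n) as a rational function of x_1 over the field ℚ(x_2,…,x_n), the product x_1^m · sp^{(k,n−k)}_λ(x_1,…,x_k | x_{k+1},…,x_n) is a polynomial in x_1, and its value at x_1 = 0 equals sp^{(k−1,n−k)}_{(λ_2,…,λ_n)}(x_2,…,x_k | x_{k+1},…,x_n) if λ_1 = m, and equals 0 if λ_1 < m. -/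
open Matrix BigOperators
open scoped Classical

noncomputable section

variable {F : Type*} [Field F]

open Polynomial

/-- The variables indexed by `k ≤ l`, i.e. those after the bar. -/
abbrev barSet (N k : ℕ) : Finset (Fin N) := Finset.univ.filter fun l : Fin N => k ≤ (l : ℕ)

lemma card_barSet {N k : ℕ} (hk : k ≤ N) : (barSet N k).card = N - k := by
  have h := Finset.card_filter_add_card_filter_not (s := (Finset.univ : Finset (Fin N)))
    (fun l : Fin N => (l : ℕ) < k)
  have e : barSet N k = Finset.univ.filter fun l : Fin N => ¬ (l : ℕ) < k := by
    ext
    simp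
  rw [← e, Fin.card_filter_val_lt, Finset.card_univ, Fintype.card_fin, min_eq_right hk] at h
  omega

/-- The entry of `Ā` with exponent `e` in a column with variable `t` before the bar. -/
def symEntry {N : ℕ} (k : ℕ) (z : Fin N → F) (t : F) (e : ℤ) : F :=
  t ^ e / ∏ l ∈ barSet N k, (1 - t⁻¹ * z l) - t ^ (-e) / ∏ l ∈ barSet N k, (1 - t * z l)

lemma symEntry_inv {N : ℕ} (k : ℕ) (z : Fin N → F) (t : F) (e : ℤ) :
    symEntry k z t⁻¹ e = -symEntry k z t e := by
  simp [symEntry]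

lemma symEntry_of_inv_eq {N : ℕ} (k : ℕ) (z : Fin N → F) {t : F} (ht : t⁻¹ = t) (e : ℤ) :
    symEntry k z t e = 0 := by
  rw [symEntry, _root_.zpow_neg, ← _root_.inv_zpow, ht, sub_self]

/-- All columns but the first one of `Ā_λ`, in terms of the variables `x_2, …, x_n`. -/
def restMat {N : ℕ} (k : ℕ) (z : Fin N → F) (lam : Fin (N + 1) → ℕ) :
    Matrix (Fin (N + 1)) (Fin N) F :=
  Matrix.of fun i j =>
    if (j : ℕ) < k then symEntry k z (z j) (lam i + ((k + 1 : ℕ) : ℤ) - (i : ℕ))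
    else z j ^ ((lam i : ℤ) + ((N + 1 : ℕ) : ℤ) - 1 - (i : ℕ))

lemma prod_filter_cons {N k : ℕ} (z : Fin N → F) (t : F) (f : F → F) :
    ∏ l ∈ Finset.univ.filter (fun l : Fin (N + 1) => k + 1 ≤ (l : ℕ)),
      f ((Fin.cons t z : Fin (N + 1) → F) l) = ∏ l ∈ barSet N k, f (z l) := by
  simp [Finset.prod_filter, Fin.prod_univ_succ]

lemma interMatP_cons_zero {N k : ℕ} (z : Fin N → F) (t : F) (lam : Fin (N + 1) → ℕ)
    (i : Fin (N + 1)) :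
    interMatP (k + 1) (Fin.cons t z : Fin (N + 1) → F) (fun i => (lam i : ℤ)) i 0 =
      symEntry k z t (lam i + ((k + 1 : ℕ) : ℤ) - (i : ℕ)) := by
  simp only [interMatP, Matrix.of_apply, Fin.val_zero, Nat.zero_lt_succ, if_true, Fin.cons_zero,
    symEntry]
  rw [prod_filter_cons z t fun y => 1 - t⁻¹ * y, prod_filter_cons z t fun y => 1 - t * y]

lemma interMatP_cons_succ {N k : ℕ} (z : Fin N → F) (t : F) (lam : Fin (N + 1) → ℕ)
    (i : Fin (N + 1)) (j : Fin N) :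
    interMatP (k + 1) (Fin.cons t z : Fin (N + 1) → F) (fun i => (lam i : ℤ)) i j.succ =
      restMat k z lam i j := by
  simp only [interMatP, restMat, Matrix.of_apply, Fin.val_succ, Nat.add_lt_add_iff_right,
    Fin.cons_succ, symEntry]
  rw [prod_filter_cons z t fun y => 1 - (z j)⁻¹ * y, prod_filter_cons z t fun y => 1 - z j * y]

/-- The minors complementary to the first column of `Ā_λ`. -/
def minor {N : ℕ} (k : ℕ) (z : Fin N → F) (lam : Fin (N + 1) → ℕ) (i : Fin (N + 1)) : F :=
  ((restMat k z lam).submatrix i.succAbove id).det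

lemma det_interMatP_cons {N k : ℕ} (z : Fin N → F) (t : F) (lam : Fin (N + 1) → ℕ) :
    (interMatP (k + 1) (Fin.cons t z : Fin (N + 1) → F) (fun i => (lam i : ℤ))).det =
      ∑ i : Fin (N + 1), (-1) ^ (i : ℕ) * symEntry k z t (lam i + ((k + 1 : ℕ) : ℤ) - (i : ℕ)) *
        minor k z lam i := by
  rw [Matrix.det_succ_column_zero]
  refine Finset.sum_congr rfl fun i _ => ?_
  rw [interMatP_cons_zero, minor]
  congr 2
  ext a b
  simp only [Matrix.submatrix_apply, id, interMatP_cons_succ]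

lemma minor_zero {N k : ℕ} (z : Fin N → F) (lam : Fin (N + 1) → ℕ) :
    minor k z lam 0 = (interMatP k z fun i => (lam i.succ : ℤ)).det := by
  rw [minor]
  congr 1
  ext a b
  simp only [Matrix.submatrix_apply, id, restMat, interMatP, Matrix.of_apply, symEntry,
    Fin.succAbove_zero, Fin.val_succ]
  have e1 : (lam a.succ : ℤ) + ((k + 1 : ℕ) : ℤ) - ((a + 1 : ℕ) : ℤ) = lam a.succ + k - (a : ℕ) := by
    push_cast
    ring
  have e2 : (lam a.succ : ℤ) + ((N + 1 : ℕ) : ℤ) - 1 - ((a + 1 : ℕ) : ℤ) =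
      lam a.succ + N - 1 - (a : ℕ) := by
    push_cast
    ring
  rw [e1, e2]

lemma sum_mul_minor_eq_zero {N k : ℕ} (z : Fin N → F) (lam : Fin (N + 1) → ℕ) (j : Fin N) (c : F)
    {v : Fin (N + 1) → F} (hv : ∀ i, v i = c * restMat k z lam i j) :
    ∑ i : Fin (N + 1), (-1) ^ (i : ℕ) * v i * minor k z lam i = 0 := by
  have h : (Matrix.of fun i => (Fin.cons (restMat k z lam i j) (restMat k z lam i) :
      Fin (N + 1) → F)).det = 0 :=
    Matrix.det_zero_of_column_eq (Fin.succ_ne_zero j).symm fun i => by simp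
  rw [Matrix.det_succ_column_zero] at h
  rw [← mul_zero c, ← h, Finset.mul_sum]
  refine Finset.sum_congr rfl fun i _ => ?_
  have h2 : minor k z lam i = (Matrix.submatrix (Matrix.of fun i =>
      (Fin.cons (restMat k z lam i j) (restMat k z lam i) : Fin (N + 1) → F))
      i.succAbove Fin.succ).det := by
    rw [minor]
    congr 1
  rw [← h2, hv]
  simp only [Matrix.of_apply, Fin.cons_zero]
  ring

/-- The first column of `Ā_λ` with denominators cleared, as polynomials in `x_1`. -/
def colPoly {N : ℕ} (k : ℕ) (z : Fin N → F) (lam : Fin (N + 1) → ℕ) (i : Fin (N + 1)) : F[X] :=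
  X ^ (lam 0 + (k + 1) + lam i + (N + 1 - i)) * ∏ l ∈ barSet N k, (1 - X * C (z l)) -
    X ^ (lam 0 - lam i + i) * ∏ l ∈ barSet N k, (X - C (z l))

/-- `det Ā_λ` with the denominators involving `x_1` cleared, as a polynomial in `x_1`. -/
def detPoly {N : ℕ} (k : ℕ) (z : Fin N → F) (lam : Fin (N + 1) → ℕ) : F[X] :=
  ∑ i : Fin (N + 1), colPoly k z lam i * C ((-1) ^ (i : ℕ) * minor k z lam i)

/-- The common denominator cleared in `colPoly`. -/
def clearFactor {N : ℕ} (k : ℕ) (z : Fin N → F) (t : F) : F :=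
  (∏ l ∈ barSet N k, (t - z l)) * ∏ l ∈ barSet N k, (1 - t * z l)

section Extension

variable {K : Type*} [Field K] [Algebra F K]

lemma aeval_colPoly_eq {N k : ℕ} (z : Fin N → F) (lam : Fin (N + 1) → ℕ) (t : K)
    (i : Fin (N + 1)) :
    aeval t (colPoly k z lam i) =
      t ^ (lam 0 + (k + 1) + lam i + (N + 1 - i)) *
          ∏ l ∈ barSet N k, (1 - t * algebraMap F K (z l)) -
        t ^ (lam 0 - lam i + i) * ∏ l ∈ barSet N k, (t - algebraMap F K (z l)) := by
  simp only [colPoly, map_sub, map_mul, map_pow, map_prod, map_one, aeval_X, aeval_C]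

lemma prod_sub_eq_pow_mul_prod {N k : ℕ} (hk : k ≤ N) (z : Fin N → F) {t : F} (ht : t ≠ 0) :
    ∏ l ∈ barSet N k, (t - z l) = t ^ (N - k) * ∏ l ∈ barSet N k, (1 - t⁻¹ * z l) := by
  rw [← card_barSet hk, ← Finset.prod_const, ← Finset.prod_mul_distrib]
  refine Finset.prod_congr rfl fun l _ => ?_
  field_simp

lemma aeval_colPoly {N k : ℕ} (hk : k ≤ N) (z : Fin N → F) (lam : Fin (N + 1) → ℕ)
    (hlam : ∀ i, lam i ≤ lam 0) {t : K} (ht : t ≠ 0)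
    (h : clearFactor k (algebraMap F K ∘ z) t ≠ 0) (i : Fin (N + 1)) :
    aeval t (colPoly k z lam i) =
      t ^ (lam 0 + (k + 1)) * clearFactor k (algebraMap F K ∘ z) t *
        symEntry k (algebraMap F K ∘ z) t (lam i + ((k + 1 : ℕ) : ℤ) - (i : ℕ)) := by
  rw [aeval_colPoly_eq]
  have h1 := left_ne_zero_of_mul h
  have h2 := right_ne_zero_of_mul h
  have h3 := prod_sub_eq_pow_mul_prod hk (algebraMap F K ∘ z) ht
  have h4 := h1
  rw [h3] at h4
  have h5 := right_ne_zero_of_mul h4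
  simp only [symEntry, clearFactor, Function.comp_apply] at *
  set A := ∏ l ∈ barSet N k, (t - algebraMap F K (z l))
  set B := ∏ l ∈ barSet N k, (1 - t * algebraMap F K (z l))
  set E := ∏ l ∈ barSet N k, (1 - t⁻¹ * algebraMap F K (z l))
  have hi := i.isLt
  have e1 : t ^ (lam 0 + (k + 1) + lam i + (N + 1 - i)) =
      t ^ (lam 0 + (k + 1)) * t ^ (N - k) * t ^ ((lam i : ℤ) + ((k + 1 : ℕ) : ℤ) - (i : ℕ)) := by
    simp only [← zpow_natCast, ← zpow_add₀ ht]
    congr 1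
    have : ((N + 1 - i : ℕ) : ℤ) = N + 1 - (i : ℕ) := by push_cast [hi.le]; ring
    push_cast [hk, this]
    ring
  have e2 : t ^ (lam 0 - lam i + i) =
      t ^ (lam 0 + (k + 1)) * t ^ (-((lam i : ℤ) + ((k + 1 : ℕ) : ℤ) - (i : ℕ))) := by
    simp only [← zpow_natCast, ← zpow_add₀ ht]
    congr 1
    push_cast [hlam i]
    ring
  rw [e1, e2]
  generalize t ^ ((lam i : ℤ) + ((k + 1 : ℕ) : ℤ) - (i : ℕ)) = u
  generalize t ^ (-((lam i : ℤ) + ((k + 1 : ℕ) : ℤ) - (i : ℕ))) = u'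
  rw [h3]
  field_simp

lemma map_minor {N k : ℕ} (z : Fin N → F) (lam : Fin (N + 1) → ℕ) (i : Fin (N + 1)) :
    algebraMap F K (minor k z lam i) = minor k (algebraMap F K ∘ z) lam i := by
  rw [minor, minor, RingHom.map_det]
  congr 1
  ext a b
  simp only [RingHom.mapMatrix_apply, Matrix.map_apply, Matrix.submatrix_apply, restMat,
    Matrix.of_apply, apply_ite (algebraMap F K), symEntry]
  simp [map_prod]

lemma aeval_detPoly {N k : ℕ} (hk : k ≤ N) (z : Fin N → F) (lam : Fin (N + 1) → ℕ)
    (hlam : ∀ i, lam i ≤ lam 0) {t : K} (ht : t ≠ 0)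
    (h : clearFactor k (algebraMap F K ∘ z) t ≠ 0) :
    aeval t (detPoly k z lam) =
      t ^ (lam 0 + (k + 1)) * clearFactor k (algebraMap F K ∘ z) t *
        (interMatP (k + 1) (Fin.cons t (algebraMap F K ∘ z) : Fin (N + 1) → K)
          (fun i => (lam i : ℤ))).det := by
  rw [det_interMatP_cons, detPoly, map_sum, Finset.mul_sum]
  refine Finset.sum_congr rfl fun i _ => ?_
  rw [map_mul, aeval_colPoly hk z lam hlam ht h, aeval_C, map_mul, map_minor]
  simp only [map_pow, map_neg, map_one]
  ring

end Extension

lemma eval_zero_detPoly {N k : ℕ} (z : Fin N → F) (lam : Fin (N + 1) → ℕ) :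
    (detPoly k z lam).eval 0 =
      -(∏ l ∈ barSet N k, (-z l)) * (interMatP k z fun i => (lam i.succ : ℤ)).det := by
  rw [detPoly, eval_finsetSum, Finset.sum_eq_single 0]
  · simp [colPoly, eval_prod, minor_zero]
  · intro i _ hi
    have h : (i : ℕ) ≠ 0 := fun h => hi (Fin.ext h)
    have h1 : lam 0 + (k + 1) + lam i + (N + 1 - i) ≠ 0 := by omega
    have h2 : lam 0 - lam i + i ≠ 0 := by omega
    rw [eval_mul, colPoly, eval_sub, eval_mul, eval_mul, eval_pow, eval_pow, eval_X, zero_pow h1,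
      zero_pow h2, zero_mul, zero_mul, sub_zero, zero_mul]
  · simp

/-- The variables are nonzero, distinct, and no two (possibly equal ones) are mutually inverse. -/
structure IsGeneric {N : ℕ} (z : Fin N → F) : Prop where
  ne_zero : ∀ i, z i ≠ 0
  injective : Function.Injective z
  mul_ne_one : ∀ i j, z i * z j ≠ 1

/-- The zeros in `x_1` of `det Ā_λ`. -/
def zeroPoint {N : ℕ} (z : Fin N → F) : Fin (N + 1) ⊕ Fin (N + 1) → F :=
  Sum.elim (Fin.cons 1 z) (Fin.cons (-1) fun j => (z j)⁻¹)

lemma IsGeneric.zeroPoint_injective {N : ℕ} {z : Fin N → F} (hz : IsGeneric z)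
    (h2 : (2 : F) ≠ 0) : Function.Injective (zeroPoint z) := by
  have h1 : (1 : F) ≠ -1 := fun h => h2 (by linear_combination h)
  have hp (j) : z j ≠ 1 := fun h => hz.mul_ne_one j j (by simp [h])
  have hm (j) : z j ≠ -1 := fun h => hz.mul_ne_one j j (by simp [h])
  have hm' (j) : (z j)⁻¹ ≠ -1 := fun h => hm j (by rw [← inv_inv (z j), h, inv_neg, inv_one])
  refine Function.Injective.sumElim ?_ ?_ ?_
  · rw [Fin.cons_injective_iff]
    exact ⟨fun ⟨j, hj⟩ => hp j hj, hz.injective⟩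
  · rw [Fin.cons_injective_iff]
    exact ⟨fun ⟨j, hj⟩ => hm' j hj, inv_injective.comp hz.injective⟩
  · intro a b
    refine Fin.cases ?_ (fun i => ?_) a <;> refine Fin.cases ?_ (fun j => ?_) b
    · simpa using h1
    · simpa [eq_comm] using hp j
    · simpa using hm i
    · simpa [mul_eq_one_iff_eq_inv₀ (hz.ne_zero j)] using hz.mul_ne_one i j

lemma eval_detPoly_zeroPoint {N k : ℕ} (hk : k ≤ N) {z : Fin N → F} (hz : IsGeneric z)
    (lam : Fin (N + 1) → ℕ) (hlam : ∀ i, lam i ≤ lam 0) (s : Fin (N + 1) ⊕ Fin (N + 1)) :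
    (detPoly k z lam).eval (zeroPoint z s) = 0 := by
  have hsum (t : F) : (detPoly k z lam).eval t = ∑ i : Fin (N + 1), (-1) ^ (i : ℕ) *
      aeval t (colPoly k z lam i) * minor k z lam i := by
    rw [detPoly, eval_finsetSum]
    refine Finset.sum_congr rfl fun i _ => ?_
    rw [eval_mul, eval_C, coe_aeval_eq_eval]
    ring
  have hcol {t : F} (ht : t ≠ 0) (h1 : ∀ l ∈ barSet N k, t ≠ z l)
      (h2 : ∀ l ∈ barSet N k, t * z l ≠ 1) (i : Fin (N + 1)) :=
    aeval_colPoly hk z lam hlam ht (mul_ne_zero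
      (Finset.prod_ne_zero_iff.mpr fun l hl => sub_ne_zero.mpr (h1 l hl))
      (Finset.prod_ne_zero_iff.mpr fun l hl => sub_ne_zero.mpr (h2 l hl).symm)) i
  have hself {t : F} (ht : t * t = 1) : (detPoly k z lam).eval t = 0 := by
    have ht0 : t ≠ 0 := by rintro rfl; simp at ht
    have hne (l) : t ≠ z l := fun h => hz.mul_ne_one l l (by rw [← h, ht])
    have hinv : t⁻¹ = t := inv_eq_of_mul_eq_one_right ht
    rw [hsum]
    refine Finset.sum_eq_zero fun i _ => ?_
    rw [hcol ht0 (fun l _ => hne l) (fun l _ h => hne l (by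
      rw [← hinv]; exact inv_eq_of_mul_eq_one_right h)), symEntry_of_inv_eq _ _ hinv]
    ring
  have hinj {j l : Fin N} (hj : (j : ℕ) < k) (hl : l ∈ barSet N k) : z j ≠ z l := by
    intro h
    have := hz.injective h
    simp only [Finset.mem_filter, Finset.mem_univ, true_and] at hl
    subst this
    omega
  rcases s with s | s <;> refine Fin.cases ?_ (fun j => ?_) s
  · exact hself (by simp [zeroPoint])
  · simp only [zeroPoint, Sum.elim_inl, Fin.cons_succ]
    rw [hsum]
    by_cases hj : (j : ℕ) < k
    · refine sum_mul_minor_eq_zero z lam j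
        (z j ^ (lam 0 + (k + 1)) * clearFactor k (algebraMap F F ∘ z) (z j)) fun i => ?_
      rw [hcol (hz.ne_zero j) (fun l hl => hinj hj hl) (fun l _ => hz.mul_ne_one j l) i,
        restMat, Matrix.of_apply, if_pos hj]
      rfl
    · refine sum_mul_minor_eq_zero z lam j
        (z j ^ (lam 0 + (k + 1) + 1) * ∏ l ∈ barSet N k, (1 - z j * z l)) fun i => ?_
      have hi := i.isLt
      rw [aeval_colPoly_eq, restMat, Matrix.of_apply, if_neg hj, Finset.prod_eq_zero (i := j)
        (f := fun l => z j - algebraMap F F (z l)) (by simpa using hj) (by simp)]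
      have e : z j ^ (lam 0 + (k + 1) + lam i + (N + 1 - i)) = z j ^ (lam 0 + (k + 1) + 1) *
          z j ^ ((lam i : ℤ) + ((N + 1 : ℕ) : ℤ) - 1 - (i : ℕ)) := by
        simp only [← zpow_natCast, ← zpow_add₀ (hz.ne_zero j)]
        congr 1
        have : ((N + 1 - i : ℕ) : ℤ) = N + 1 - (i : ℕ) := by push_cast [hi.le]; ring
        push_cast [this]
        ring
      rw [e]
      simp only [Algebra.algebraMap_self, RingHom.id_apply]
      ring
  · exact hself (by simp [zeroPoint])
  · simp only [zeroPoint, Sum.elim_inr, Fin.cons_succ]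
    rw [hsum]
    by_cases hj : (j : ℕ) < k
    · refine sum_mul_minor_eq_zero z lam j
        (-((z j)⁻¹ ^ (lam 0 + (k + 1)) * clearFactor k (algebraMap F F ∘ z) (z j)⁻¹)) fun i => ?_
      rw [hcol (inv_ne_zero (hz.ne_zero j)) (fun l _ h => hz.mul_ne_one j l (by
        rw [← h, mul_inv_cancel₀ (hz.ne_zero j)])) (fun l hl h => hinj hj hl (by
        rw [← inv_inv (z j)]; exact inv_eq_of_mul_eq_one_right h)) i,
        restMat, Matrix.of_apply, if_pos hj, symEntry_inv]
      simp only [mul_neg, neg_mul]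
      rfl
    · refine sum_mul_minor_eq_zero z lam j (-(z j ^ (-((lam 0 : ℤ) + N)) *
        ∏ l ∈ barSet N k, ((z j)⁻¹ - z l))) fun i => ?_
      rw [aeval_colPoly_eq, restMat, Matrix.of_apply, if_neg hj, Finset.prod_eq_zero (i := j)
        (f := fun l => 1 - (z j)⁻¹ * algebraMap F F (z l)) (by simpa using hj)
        (by simp [hz.ne_zero j])]
      have e : (z j)⁻¹ ^ (lam 0 - lam i + i) = z j ^ (-((lam 0 : ℤ) + N)) *
          z j ^ ((lam i : ℤ) + ((N + 1 : ℕ) : ℤ) - 1 - (i : ℕ)) := by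
        rw [inv_pow, ← zpow_natCast, ← _root_.zpow_neg, ← zpow_add₀ (hz.ne_zero j)]
        congr 1
        push_cast [hlam i]
        ring
      rw [e]
      simp only [Algebra.algebraMap_self, RingHom.id_apply]
      ring

/-- The monic polynomial in `x_1` dividing every `det Ā_λ`. -/
def zeroPoly {N : ℕ} (z : Fin N → F) : F[X] := ∏ s, (X - C (zeroPoint z s))

lemma zeroPoly_dvd_detPoly {N k : ℕ} (hk : k ≤ N) {z : Fin N → F} (hz : IsGeneric z)
    (h2 : (2 : F) ≠ 0) (lam : Fin (N + 1) → ℕ) (hlam : ∀ i, lam i ≤ lam 0) :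
    zeroPoly z ∣ detPoly k z lam :=
  Finset.prod_dvd_of_coprime
    (fun _ _ _ _ h => pairwise_coprime_X_sub_C (hz.zeroPoint_injective h2) h)
    fun s _ => dvd_iff_isRoot.mpr (eval_detPoly_zeroPoint hk hz lam hlam s)

lemma natDegree_detPoly_zero_le {N k : ℕ} (hk : k ≤ N) (z : Fin N → F) :
    (detPoly k z 0).natDegree ≤ 2 * (N + 1) := by
  refine natDegree_sum_le_of_forall_le _ _ fun i _ => (natDegree_mul_C_le _ _).trans ?_
  have hi := i.isLt
  have hc := card_barSet hk
  have hA : (∏ l ∈ barSet N k, (1 - X * C (z l))).natDegree ≤ N - k := by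
    rw [← hc, ← smul_eq_mul (a := (barSet N k).card) (b := 1) |>.trans (mul_one _)]
    refine (natDegree_prod_le _ _).trans (Finset.sum_le_card_nsmul _ _ _ fun l _ => ?_)
    compute_degree
  have hB : (∏ l ∈ barSet N k, (X - C (z l))).natDegree ≤ N - k := by
    rw [natDegree_finsetProd_X_sub_C_eq_card, hc]
  refine (natDegree_sub_le _ _).trans (max_le ?_ ?_)
  · refine natDegree_mul_le.trans ((add_le_add (natDegree_X_pow_le _) hA).trans ?_)
    simp only [Pi.zero_apply]
    omega
  · refine natDegree_mul_le.trans ((add_le_add (natDegree_X_pow_le _) hB).trans ?_)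
    simp only [Pi.zero_apply]
    omega

lemma exists_detPoly_zero_eq {N k : ℕ} (hk : k ≤ N) {z : Fin N → F} (hz : IsGeneric z)
    (h2 : (2 : F) ≠ 0) : ∃ c : F, detPoly k z 0 = zeroPoly z * C c := by
  obtain ⟨q, hq⟩ := zeroPoly_dvd_detPoly hk hz h2 0 fun _ => le_rfl
  have hmonic : (zeroPoly z).Monic := monic_prod_of_monic _ _ fun s _ => monic_X_sub_C _
  have hdeg : (zeroPoly z).natDegree = 2 * (N + 1) := by
    rw [zeroPoly, natDegree_finsetProd_X_sub_C_eq_card]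
    simp [two_mul]
  have hle := natDegree_detPoly_zero_le hk z
  by_cases hq0 : q = 0
  · exact ⟨0, by rw [hq, hq0, C_0]⟩
  rw [hq, hmonic.natDegree_mul' hq0, hdeg] at hle
  exact ⟨q.coeff 0, by rw [hq, ← eq_C_of_natDegree_eq_zero (by omega)]⟩

lemma det_interMatP_zero_zero_ne_zero {N : ℕ} {z : Fin N → F} (hz : Function.Injective z) :
    (interMatP 0 z fun _ => 0).det ≠ 0 := by
  have h : interMatP 0 z (fun _ => 0) =
      ((Matrix.vandermonde z).transpose.submatrix Fin.revPerm id) := by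
    ext i j
    simp only [interMatP, Nat.not_lt_zero, if_false, Matrix.of_apply, Matrix.submatrix_apply,
      Matrix.transpose_apply, Matrix.vandermonde_apply, id, Fin.revPerm_apply, Fin.val_rev,
      ← zpow_natCast]
    congr 1
    have := i.isLt
    push_cast [Nat.succ_le_of_lt this]
    ring
  rw [h, Matrix.det_permute, Matrix.det_transpose]
  refine mul_ne_zero ?_ (Matrix.det_vandermonde_ne_zero_iff.mpr hz)
  rcases Int.units_eq_one_or (Equiv.Perm.sign (Fin.revPerm : Equiv.Perm (Fin N))) with h | h <;>
    simp [h]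

lemma IsGeneric.tail {N : ℕ} {z : Fin (N + 1) → F} (hz : IsGeneric z) :
    IsGeneric (Fin.tail z) where
  ne_zero i := hz.ne_zero i.succ
  injective := hz.injective.comp (Fin.succ_injective N)
  mul_ne_one i j := hz.mul_ne_one i.succ j.succ

lemma IsGeneric.prod_neg_ne_zero {N : ℕ} {z : Fin N → F} (hz : IsGeneric z) (k : ℕ) :
    -(∏ l ∈ barSet N k, (-z l)) ≠ 0 :=
  neg_ne_zero.mpr (Finset.prod_ne_zero_iff.mpr fun l _ => neg_ne_zero.mpr (hz.ne_zero l))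

lemma eval_zero_detPoly_zero_ne_zero {N k : ℕ} {z : Fin N → F} (hz : IsGeneric z)
    (hdet : (interMatP k z fun _ => 0).det ≠ 0) : (detPoly k z 0).eval 0 ≠ 0 := by
  rw [eval_zero_detPoly]
  exact mul_ne_zero (hz.prod_neg_ne_zero k) (by simpa using hdet)

theorem det_interMatP_zero_ne_zero (h2 : (2 : F) ≠ 0) {N k : ℕ} (hk : k ≤ N) {z : Fin N → F}
    (hz : IsGeneric z) : (interMatP k z fun _ => 0).det ≠ 0 := by
  induction k generalizing N with
  | zero => exact det_interMatP_zero_zero_ne_zero hz.injective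
  | succ k ih =>
    obtain ⟨N, rfl⟩ : ∃ M, N = M + 1 := ⟨N - 1, by omega⟩
    have hkN : k ≤ N := by omega
    have ht := hz.tail
    obtain ⟨c, hc⟩ := exists_detPoly_zero_eq hkN ht h2
    have h0 := eval_zero_detPoly_zero_ne_zero ht (ih hkN ht)
    rw [hc, eval_mul, eval_C] at h0
    have hD : (zeroPoly (Fin.tail z)).eval (z 0) ≠ 0 := by
      rw [zeroPoly, eval_prod, Finset.prod_ne_zero_iff]
      rintro (s | s) - <;> refine Fin.cases ?_ (fun j => ?_) s <;>
        simp only [zeroPoint, Sum.elim_inl, Sum.elim_inr, Fin.cons_zero, Fin.cons_succ, eval_sub,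
          eval_X, eval_C, sub_ne_zero]
      · exact fun h => hz.mul_ne_one 0 0 (by simp [h])
      · exact fun h => Fin.succ_ne_zero j (hz.injective h).symm
      · exact fun h => hz.mul_ne_one 0 0 (by simp [h])
      · exact fun h => hz.mul_ne_one 0 j.succ (by
          rw [h]; exact inv_mul_cancel₀ (ht.ne_zero j))
    have hP : aeval (z 0) (detPoly k (Fin.tail z) 0) ≠ 0 := by
      rw [hc, coe_aeval_eq_eval, eval_mul, eval_C]
      exact mul_ne_zero hD (right_ne_zero_of_mul h0)
    rw [aeval_detPoly hkN _ 0 (fun _ => le_rfl) (hz.ne_zero 0)] at hP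
    · have := right_ne_zero_of_mul hP
      simpa [Function.comp_def, Fin.cons_self_tail] using this
    · refine mul_ne_zero (Finset.prod_ne_zero_iff.mpr fun l _ => sub_ne_zero.mpr fun h => ?_)
        (Finset.prod_ne_zero_iff.mpr fun l _ => sub_ne_zero.mpr (hz.mul_ne_one 0 l.succ).symm)
      exact Fin.succ_ne_zero l (hz.injective h).symm

/-- The reduction for a generic specialization of `x_2, …, x_n` in an arbitrary field. -/
theorem exists_polynomial_X_pow_mul_spInterP (h2 : (2 : F) ≠ 0) {N k m : ℕ} (hk : k ≤ N)
    {z : Fin N → F} (hz : IsGeneric z) (lam : Fin (N + 1) → ℕ) (hlam : ∀ i, lam i ≤ lam 0)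
    (hm : lam 0 ≤ m) :
    ∃ p : F[X],
      (RatFunc.X : RatFunc F) ^ m *
          spInterP (k + 1) (Fin.cons RatFunc.X (algebraMap F (RatFunc F) ∘ z) :
            Fin (N + 1) → RatFunc F) (fun i => (lam i : ℤ)) =
        algebraMap F[X] (RatFunc F) p ∧
      p.eval 0 = if lam 0 = m then spInterP k z (fun i => (lam i.succ : ℤ)) else 0 := by
  obtain ⟨c, hc⟩ := exists_detPoly_zero_eq hk hz h2
  obtain ⟨q, hq⟩ := zeroPoly_dvd_detPoly hk hz h2 lam hlam
  have hdet := det_interMatP_zero_ne_zero h2 hk hz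
  have h0 := eval_zero_detPoly_zero_ne_zero hz hdet
  have hc0 : c ≠ 0 := by
    rintro rfl
    simp [hc] at h0
  have hD0 : zeroPoly z ≠ 0 := by
    intro h
    simp [hc, h] at h0
  refine ⟨X ^ (m - lam 0) * q * C c⁻¹, ?_, ?_⟩
  · have hX : (RatFunc.X : RatFunc F) ≠ 0 := RatFunc.X_ne_zero
    have hclear : clearFactor k (algebraMap F (RatFunc F) ∘ z) RatFunc.X ≠ 0 := by
      have : clearFactor k (algebraMap F (RatFunc F) ∘ z) RatFunc.X =
          algebraMap F[X] (RatFunc F)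
            ((∏ l ∈ barSet N k, (X - C (z l))) * ∏ l ∈ barSet N k, (1 - X * C (z l))) := by
        simp only [clearFactor, Function.comp_apply, map_mul, map_prod, map_sub, map_one,
          RatFunc.algebraMap_X, RatFunc.algebraMap_C, RatFunc.algebraMap_eq_C]
      rw [this]
      refine RatFunc.algebraMap_ne_zero (mul_ne_zero
        (Finset.prod_ne_zero_iff.mpr fun l _ => X_sub_C_ne_zero _)
        (Finset.prod_ne_zero_iff.mpr fun l _ h => ?_))
      simpa using congrArg (eval 0) h
    have e1 := aeval_detPoly hk z lam hlam hX hclear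
    have e2 := aeval_detPoly hk z 0 (fun _ => le_rfl) hX hclear
    rw [hq, RatFunc.aeval_X_left_eq_algebraMap, map_mul] at e1
    rw [hc, RatFunc.aeval_X_left_eq_algebraMap, map_mul] at e2
    simp only [Pi.zero_apply, Nat.cast_zero, zero_add] at e2
    have hDr : algebraMap F[X] (RatFunc F) (zeroPoly z) ≠ 0 := RatFunc.algebraMap_ne_zero hD0
    have hcr : algebraMap F[X] (RatFunc F) (C c) ≠ 0 :=
      RatFunc.algebraMap_ne_zero (C_ne_zero.mpr hc0)
    have hcinv : algebraMap F[X] (RatFunc F) (C c⁻¹) = (algebraMap F[X] (RatFunc F) (C c))⁻¹ := by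
      rw [← mul_eq_one_iff_eq_inv₀ hcr, ← map_mul, ← C_mul, inv_mul_cancel₀ hc0, C_1, map_one]
    rw [map_mul, map_mul, hcinv, map_pow, RatFunc.algebraMap_X, spInterP]
    have hd := right_ne_zero_of_mul (e2 ▸ mul_ne_zero hDr hcr)
    rw [mul_div_assoc', div_eq_iff hd, mul_right_comm, ← div_eq_mul_inv, eq_div_iff hcr]
    refine mul_left_cancel₀ (mul_ne_zero (mul_ne_zero (pow_ne_zero (k + 1) hX) hclear) hDr) ?_
    obtain ⟨d, rfl⟩ := Nat.exists_eq_add_of_le hm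
    rw [Nat.add_sub_cancel_left, pow_add]
    rw [pow_add] at e1
    generalize algebraMap F[X] (RatFunc F) (zeroPoly z) = D at *
    generalize algebraMap F[X] (RatFunc F) (C c) = c' at *
    linear_combination (-(RatFunc.X : RatFunc F) ^ d * c' * D) * e1 +
      (RatFunc.X : RatFunc F) ^ d * algebraMap F[X] (RatFunc F) q * D * e2
  · split_ifs with h
    · have e1 := eval_zero_detPoly (k := k) z lam
      have e2 := eval_zero_detPoly (k := k) z 0
      rw [hc, eval_mul, eval_C] at e2 h0
      rw [hq, eval_mul] at e1
      simp only [Pi.zero_apply, Nat.cast_zero] at e2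
      have hs := hz.prod_neg_ne_zero k
      rw [h, Nat.sub_self, pow_zero, one_mul, eval_mul, eval_C, spInterP, eq_div_iff hdet,
        mul_right_comm, ← div_eq_mul_inv, div_eq_iff hc0]
      refine mul_left_cancel₀ (mul_ne_zero hs (left_ne_zero_of_mul h0)) ?_
      generalize (zeroPoly z).eval 0 = D at *
      linear_combination (-D * q.eval 0) * e2 + (D * c) * e1
    · have : m - lam 0 ≠ 0 := by omega
      simp [this]

lemma isGeneric_gen (N : ℕ) : IsGeneric (gen N) := by
  have hinj := IsFractionRing.injective (MvPolynomial (Fin N) ℚ) (FF N)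
  refine ⟨fun i h => ?_, hinj.comp MvPolynomial.X_injective, fun i j h => ?_⟩
  · exact MvPolynomial.X_ne_zero i (hinj (h.trans (map_zero _).symm))
  · rw [gen, gen, ← map_mul, ← map_one (algebraMap (MvPolynomial (Fin N) ℚ) (FF N))] at h
    simpa using congrArg (MvPolynomial.eval fun _ => (0 : ℚ)) (hinj h)

/-- **Lemma (reduction lemma, part (1)).**  Let `0 < k ≤ n`, `m` a nonnegative integer and
`λ` a partition with `λ_1 ≤ m`.  Viewing the intermediate symplectic character
`sp^{(k,n-k)}_λ(x_1, …, x_k | x_{k+1}, …, x_n)` as a rational function of `x_1` over the field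
`ℚ(x_2, …, x_n)`, the product `x_1^m · sp^{(k,n-k)}_λ` is a polynomial in `x_1`, whose value at
`x_1 = 0` is `sp^{(k-1,n-k)}_{(λ_2,…,λ_n)}(x_2, …, x_k | x_{k+1}, …, x_n)` if `λ_1 = m` and is
`0` if `λ_1 < m`.  Here the base field is `FF (n-1) = ℚ(x_2, …, x_n)` (with `gen (n-1) i`
playing the role of `x_{i+2}`), and `RatFunc.X` plays the role of `x_1`. -/
theorem spInter_mul_pow_eq_polynomial_and_eval_zero (n k m : ℕ) (hk : 0 < k) (hkn : k ≤ n)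
    (lam : Fin n → ℕ) (hanti : Antitone lam) (hlam : lam ⟨0, hk.trans_le hkn⟩ ≤ m) :
    ∃ p : Polynomial (FF (n - 1)),
      (RatFunc.X : RatFunc (FF (n - 1))) ^ m *
          spInterP k
            (fun j : Fin n =>
              if h : (j : ℕ) = 0 then RatFunc.X
              else
                algebraMap (FF (n - 1)) (RatFunc (FF (n - 1)))
                  (gen (n - 1) ⟨(j : ℕ) - 1, by have := j.isLt; omega⟩))
            (fun i => ((lam i : ℕ) : ℤ)) =
        algebraMap (Polynomial (FF (n - 1))) (RatFunc (FF (n - 1))) p ∧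
      p.eval 0 =
        if lam ⟨0, hk.trans_le hkn⟩ = m then
          spInterP (k - 1) (gen (n - 1))
            (fun i : Fin (n - 1) => ((lam ⟨(i : ℕ) + 1, by have := i.isLt; omega⟩ : ℕ) : ℤ))
        else 0 := by
  obtain ⟨N, rfl⟩ : ∃ N, n = N + 1 := ⟨n - 1, by omega⟩
  obtain ⟨k, rfl⟩ : ∃ l, k = l + 1 := ⟨k - 1, by omega⟩
  obtain ⟨p, hp, hp0⟩ := exists_polynomial_X_pow_mul_spInterP (F := FF N) two_ne_zero
    (Nat.le_of_succ_le_succ hkn) (isGeneric_gen N) lam (fun i => hanti (Fin.zero_le i)) hlam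
  refine ⟨p, ?_, hp0⟩
  refine Eq.trans ?_ hp
  congr 2
  funext j
  refine Fin.cases ?_ (fun i => ?_) j
  · simp
  · simp
end
end

section
/- Let n ≥ 1, let m ∈ ½ℤ with m ≥ 0, and let λ = (λ_1,…,λ_n) be a partition or half-partition with λ_1 ≤ m. Then, viewing the odd orthogonal character so^B_λ(x_1,…,x_n) as a rational function of t = x_1^{1/2} over the field ℚ(x_2^{1/2},…,x_n^{1/2}), the product x_1^m · so^B_λ(x_1,…,x_n) is a polynomial in t, and its value at t = 0 equals so^B_{(λ_2,…,λ_n)}(x_2,…,x_n) if λ_1 = m, and equals 0 if λ_1 < m. -/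
open Matrix BigOperators
open scoped Classical

noncomputable section

variable {F : Type*} [Field F]

/-- The matrix with entries `z_j ^ a_i - z_j ^ (-a_i)`. -/
def altMat {K : Type*} [Field K] {n N : ℕ} (z : Fin N → K) (a : Fin n → ℕ) :
    Matrix (Fin n) (Fin N) K :=
  Matrix.of fun i j => z j ^ (a i : ℤ) - z j ^ (-(a i : ℤ))

/-- The polynomial `t ^ M * ∑ i, c_i * (t ^ a_i - t ^ (-a_i))`, for `M` at least every `a_i`. -/
def altPoly {K : Type*} [Field K] {n : ℕ} (M : ℕ) (a : Fin n → ℕ) (c : Fin n → K) :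
    Polynomial K :=
  ∑ i, Polynomial.C (c i) * (Polynomial.X ^ (M + a i) - Polynomial.X ^ (M - a i))

/-- The points `±1` and `±z_j`, `±z_j⁻¹`. -/
def signedPoint {K : Type*} [Field K] {N : ℕ} (z : Fin N → K) :
    ℤˣ ⊕ (Fin N × ℤˣ × Bool) → K
  | Sum.inl s => ((s : ℤ) : K)
  | Sum.inr (j, s, e) => ((s : ℤ) : K) * (if e then z j else (z j)⁻¹)

/-- The condition ensuring that the points `±1`, `±z_j`, `±z_j⁻¹` are nonzero and distinct. -/
structure Generic {K : Type*} [Field K] {N : ℕ} (z : Fin N → K) : Prop where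
  ne_zero : ∀ i, z i ≠ 0
  sq_injective : Function.Injective fun i => z i ^ 2
  sq_mul_sq_ne_one : ∀ i j, z i ^ 2 * z j ^ 2 ≠ 1

section Field

variable {K : Type*} [Field K]

theorem intUnit_cast_sq (s : ℤˣ) : (((s : ℤ) : K)) ^ 2 = 1 := by
  rcases Int.units_eq_one_or s with rfl | rfl <;> simp

theorem intUnit_cast_injective [CharZero K] : Function.Injective fun s : ℤˣ => ((s : ℤ) : K) := by
  intro s t h
  exact Units.ext (Int.cast_injective h)

theorem signedPoint_sq {N : ℕ} (z : Fin N → K) (j : Fin N) (s : ℤˣ) (e : Bool) :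
    signedPoint z (Sum.inr (j, s, e)) ^ 2 = if e then z j ^ 2 else (z j ^ 2)⁻¹ := by
  simp only [signedPoint, mul_pow, intUnit_cast_sq, one_mul]
  split_ifs <;> simp

theorem signedPoint_inl_sq {N : ℕ} (z : Fin N → K) (s : ℤˣ) :
    signedPoint z (Sum.inl s) ^ 2 = 1 := intUnit_cast_sq s

theorem Generic.sq_ne_one {N : ℕ} {z : Fin N → K} (hz : Generic z) (i : Fin N) :
    z i ^ 2 ≠ 1 := fun h => hz.sq_mul_sq_ne_one i i (by rw [h, one_mul])

theorem Generic.sq_ne_inv {N : ℕ} {z : Fin N → K} (hz : Generic z) (i j : Fin N) :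
    z i ^ 2 ≠ (z j ^ 2)⁻¹ := fun h =>
  hz.sq_mul_sq_ne_one i j (by rw [h, inv_mul_cancel₀ (pow_ne_zero 2 (hz.ne_zero j))])

theorem signedPoint_ne_zero [CharZero K] {N : ℕ} {z : Fin N → K} (hz : Generic z)
    (k : ℤˣ ⊕ (Fin N × ℤˣ × Bool)) : signedPoint z k ≠ 0 := by
  rcases k with s | ⟨j, s, e⟩
  · intro h
    simpa [h] using signedPoint_inl_sq z s
  · have := hz.ne_zero j
    intro h
    have h2 := signedPoint_sq z j s e
    rw [h] at h2
    cases e <;> simp at h2 <;> exact pow_ne_zero 2 this h2.symm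

theorem signedPoint_injective [CharZero K] {N : ℕ} {z : Fin N → K} (hz : Generic z) :
    Function.Injective (signedPoint z) := by
  have key : ∀ (s : ℤˣ) j t e, signedPoint z (Sum.inl s) ≠ signedPoint z (Sum.inr (j, t, e)) := by
    intro s j t e h
    have h2 := congrArg (· ^ 2) h
    simp only [signedPoint_inl_sq, signedPoint_sq] at h2
    have := hz.sq_ne_one j
    cases e
    · exact this (by simpa using h2.symm)
    · exact this (by simpa using h2.symm)
  rintro (s | ⟨j, s, e⟩) (s' | ⟨j', s', e'⟩) h
  · exact congrArg _ (intUnit_cast_injective h)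
  · exact absurd h (key _ _ _ _)
  · exact absurd h.symm (key _ _ _ _)
  · have h2 := congrArg (· ^ 2) h
    simp only [signedPoint_sq] at h2
    have h3 : e = e' ∧ j = j' := by
      cases e <;> cases e' <;> simp only [if_true, Bool.false_eq_true, if_false] at h2
      · exact ⟨rfl, hz.sq_injective (inv_injective h2)⟩
      · exact absurd h2.symm (hz.sq_ne_inv _ _)
      · exact absurd h2 (hz.sq_ne_inv _ _)
      · exact ⟨rfl, hz.sq_injective h2⟩
    obtain ⟨rfl, rfl⟩ := h3
    have h4 : (if e then z j else (z j)⁻¹) ≠ 0 := by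
      have := hz.ne_zero j
      split_ifs <;> simpa
    have h5 : s = s' := intUnit_cast_injective (mul_right_cancel₀ h4 h)
    rw [h5]

theorem eval_altPoly {n : ℕ} {M : ℕ} {a : Fin n → ℕ} (ha : ∀ i, a i ≤ M) (c : Fin n → K)
    {t : K} (ht : t ≠ 0) :
    (altPoly M a c).eval t = t ^ M * ∑ i, c i * (t ^ (a i : ℤ) - t ^ (-(a i : ℤ))) := by
  simp only [altPoly, Polynomial.eval_finsetSum, Polynomial.eval_mul, Polynomial.eval_C,
    Polynomial.eval_sub, Polynomial.eval_pow, Polynomial.eval_X, Finset.mul_sum]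
  refine Finset.sum_congr rfl fun i _ => ?_
  rw [pow_sub₀ _ ht (ha i), pow_add, _root_.zpow_neg, zpow_natCast]
  ring

theorem natDegree_altPoly_le {n : ℕ} {M : ℕ} {a : Fin n → ℕ} (ha : ∀ i, a i ≤ M)
    (c : Fin n → K) : (altPoly M a c).natDegree ≤ 2 * M := by
  refine Polynomial.natDegree_sum_le_of_forall_le _ _ fun i _ => ?_
  have := ha i
  refine (Polynomial.natDegree_C_mul_le _ _).trans ((Polynomial.natDegree_sub_le _ _).trans ?_)
  simp only [Polynomial.natDegree_X_pow]
  omega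

theorem eval_zero_altPoly {k : ℕ} {a : Fin (k + 1) → ℕ} (ha : ∀ i, 0 < a i)
    (hlt : ∀ i : Fin k, a i.succ < a 0) (c : Fin (k + 1) → K) :
    (altPoly (a 0) a c).eval 0 = -c 0 := by
  simp only [altPoly, Polynomial.eval_finsetSum, Polynomial.eval_mul, Polynomial.eval_C,
    Polynomial.eval_sub, Polynomial.eval_pow, Polynomial.eval_X]
  rw [Fin.sum_univ_succ, Finset.sum_eq_zero]
  · have := ha 0
    simp [this.ne']
  · intro i _
    have h1 := hlt i
    have h2 : a 0 - a i.succ ≠ 0 := by omega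
    have h3 : a 0 + a i.succ ≠ 0 := by omega
    rw [zero_pow h2, zero_pow h3, sub_zero, mul_zero]

theorem coeff_altPoly {n : ℕ} {M : ℕ} {a : Fin n → ℕ} (hinj : Function.Injective a)
    (ha : ∀ i, 0 < a i) (c : Fin n → K) (i : Fin n) :
    (altPoly M a c).coeff (M + a i) = c i := by
  simp only [altPoly, Polynomial.finsetSum_coeff, Polynomial.coeff_C_mul, Polynomial.coeff_sub,
    Polynomial.coeff_X_pow]
  rw [Finset.sum_eq_single i]
  · have := ha i
    rw [if_pos rfl, if_neg (by omega), sub_zero, mul_one]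
  · intro l _ hl
    have := ha i
    have h1 : a i ≠ a l := fun h => hl (hinj h.symm)
    rw [if_neg (by omega), if_neg (by omega), sub_zero, mul_zero]
  · simp

theorem intUnit_cast_zpow_neg (s : ℤˣ) (a : ℤ) :
    (((s : ℤ) : K)) ^ (-a) = ((s : ℤ) : K) ^ a := by
  rcases Int.units_eq_one_or s with rfl | rfl
  · simp
  · have : (-1 : K)⁻¹ = -1 := by rw [inv_neg, inv_one]
    rw [_root_.zpow_neg, ← _root_.inv_zpow]
    simp [this]

theorem intUnit_cast_pow_congr (s : ℤˣ) {a b : ℕ} (h : a % 2 = b % 2) :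
    (((s : ℤ) : K)) ^ a = ((s : ℤ) : K) ^ b := by
  rw [← Nat.div_add_mod a 2, ← Nat.div_add_mod b 2, pow_add, pow_add, pow_mul, pow_mul,
    intUnit_cast_sq, h, one_pow, one_pow]

theorem prod_signedPoint_dvd_altPoly [CharZero K] {n N : ℕ} {z : Fin N → K} (hz : Generic z)
    {M : ℕ} {a : Fin n → ℕ} (ha : ∀ i, a i ≤ M) {ε : ℕ} (hε : ∀ i, a i % 2 = ε % 2)
    {c : Fin n → K} (hc : c ᵥ* altMat z a = 0) :
    (∏ k, (Polynomial.X - Polynomial.C (signedPoint z k))) ∣ altPoly M a c := by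
  refine Fintype.prod_dvd_of_coprime
    (Polynomial.pairwise_coprime_X_sub_C (signedPoint_injective hz)) fun k => ?_
  rw [Polynomial.dvd_iff_isRoot, Polynomial.IsRoot,
    eval_altPoly ha c (signedPoint_ne_zero hz k)]
  refine mul_eq_zero_of_right _ ?_
  rcases k with s | ⟨j, s, e⟩
  · refine Finset.sum_eq_zero fun i _ => ?_
    simp only [signedPoint]
    rw [intUnit_cast_zpow_neg, sub_self, mul_zero]
  · have h0 : ∑ i, c i * (z j ^ (a i : ℤ) - z j ^ (-(a i : ℤ))) = 0 := by
      simpa [Matrix.vecMul, dotProduct, altMat] using congrFun hc j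
    have h1 : ∀ i, c i * (signedPoint z (Sum.inr (j, s, e)) ^ (a i : ℤ) -
        signedPoint z (Sum.inr (j, s, e)) ^ (-(a i : ℤ))) =
        (((s : ℤ) : K) ^ ε * (if e then 1 else -1)) *
          (c i * (z j ^ (a i : ℤ) - z j ^ (-(a i : ℤ)))) := by
      intro i
      simp only [signedPoint]
      rw [mul_zpow, mul_zpow, intUnit_cast_zpow_neg, zpow_natCast ((s : ℤ) : K),
        intUnit_cast_pow_congr s (hε i)]
      cases e
      · simp only [Bool.false_eq_true, if_false, _root_.inv_zpow', neg_neg]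
        ring
      · simp only [if_true]
        ring
    rw [Finset.sum_congr rfl fun i _ => h1 i, ← Finset.mul_sum, h0, mul_zero]

theorem natDegree_prod_signedPoint {N : ℕ} (z : Fin N → K) :
    (∏ k, (Polynomial.X - Polynomial.C (signedPoint z k))).natDegree = 4 * N + 2 := by
  rw [Polynomial.natDegree_finsetProd_X_sub_C_eq_card]
  simp only [Finset.card_univ, Fintype.card_sum, Fintype.card_prod, Fintype.card_units_int,
    Fintype.card_fin, Fintype.card_bool]
  ring

theorem det_altMat_ne_zero [CharZero K] {N : ℕ} {z : Fin N → K} (hz : Generic z)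
    {b : Fin N → ℕ} (hinj : Function.Injective b) (hb : ∀ i, b i ≤ 2 * N)
    (hodd : ∀ i, b i % 2 = 1) : (altMat z b).det ≠ 0 := by
  intro hdet
  obtain ⟨c, hc0, hc⟩ := Matrix.exists_vecMul_eq_zero_iff.mpr hdet
  have hdvd := prod_signedPoint_dvd_altPoly hz hb (ε := 1) hodd hc
  have hzero : altPoly (2 * N) b c = 0 := by
    refine Polynomial.eq_zero_of_dvd_of_natDegree_lt hdvd ?_
    rw [natDegree_prod_signedPoint]
    have := natDegree_altPoly_le hb c
    omega
  refine hc0 (funext fun i => ?_)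
  rw [← coeff_altPoly (M := 2 * N) hinj (fun i => by have := hodd i; omega) c i, hzero]
  simp

/-- The cofactors of `altMat` along a first column of variables. -/
def altCofactor {k : ℕ} (z : Fin k → K) (a : Fin (k + 1) → ℕ) (i : Fin (k + 1)) : K :=
  (-1) ^ (i : ℕ) * (altMat z fun l => a (i.succAbove l)).det

theorem det_altMat_cons {k : ℕ} {L : Type*} [Field L] [Algebra K L] (z : Fin k → K) (t : L)
    (a : Fin (k + 1) → ℕ) :
    (altMat (Fin.cons t fun j => algebraMap K L (z j) : Fin (k + 1) → L) a).det =
      ∑ i, algebraMap K L (altCofactor z a i) * (t ^ (a i : ℤ) - t ^ (-(a i : ℤ))) := by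
  rw [Matrix.det_succ_column_zero]
  refine Finset.sum_congr rfl fun i _ => ?_
  have h : (altMat (Fin.cons t fun j => algebraMap K L (z j) : Fin (k + 1) → L) a).submatrix
      i.succAbove Fin.succ = (altMat z fun l => a (i.succAbove l)).map (algebraMap K L) := by
    ext l j
    simp [altMat]
  have h' : ((altMat z fun l => a (i.succAbove l)).map (algebraMap K L)).det =
      algebraMap K L (altMat z fun l => a (i.succAbove l)).det :=
    (RingHom.map_det (algebraMap K L) _).symm
  rw [h, h', altCofactor, map_mul, map_pow, map_neg, map_one]
  simp only [altMat, Matrix.of_apply, Fin.cons_zero]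
  ring

theorem altCofactor_vecMul {k : ℕ} (z : Fin k → K) (a : Fin (k + 1) → ℕ) :
    altCofactor z a ᵥ* altMat z a = 0 := by
  funext j
  have h := det_altMat_cons z (z j) a
  rw [Matrix.det_zero_of_column_eq (Fin.succ_ne_zero j).symm] at h
  · simpa [Matrix.vecMul, dotProduct, altMat] using h.symm
  · intro i
    simp [altMat]

theorem altCofactor_zero {k : ℕ} (z : Fin k → K) (a : Fin (k + 1) → ℕ) :
    altCofactor z a 0 = (altMat z fun l => a l.succ).det := by
  simp [altCofactor]

theorem X_pow_mul_det_altMat {k : ℕ} (z : Fin k → K) {M : ℕ} {a : Fin (k + 1) → ℕ}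
    (ha : ∀ i, a i ≤ M) :
    (RatFunc.X : RatFunc K) ^ M *
        (altMat (Fin.cons RatFunc.X fun j => algebraMap K (RatFunc K) (z j) :
          Fin (k + 1) → RatFunc K) a).det =
      algebraMap (Polynomial K) (RatFunc K) (altPoly M a (altCofactor z a)) := by
  rw [det_altMat_cons, altPoly, map_sum, Finset.mul_sum]
  refine Finset.sum_congr rfl fun i _ => ?_
  simp only [map_mul, map_sub, map_pow, RatFunc.algebraMap_X, RatFunc.algebraMap_C]
  rw [pow_sub₀ _ RatFunc.X_ne_zero (ha i), pow_add, _root_.zpow_neg, zpow_natCast,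
    RatFunc.algebraMap_eq_C]
  ring

theorem soBD_eq_det_altMat_div {N : ℕ} (z : Fin N → K) (μ : Fin N → ℤ) {a b : Fin N → ℕ}
    (ha : ∀ i, (a i : ℤ) = μ i + 2 * ((N : ℤ) - (i : ℕ)) - 1)
    (hb : ∀ i, (b i : ℤ) = 2 * ((N : ℤ) - (i : ℕ)) - 1) :
    soBD z μ = (altMat z a).det / (altMat z b).det := by
  simp only [soBD, altMat, ha, hb]

theorem exists_polynomial_X_zpow_mul_soBD [CharZero K] {k : ℕ} {z : Fin k → K} (hz : Generic z)
    {m : ℤ} {μ : Fin (k + 1) → ℤ} (hanti : Antitone μ) (hpos : ∀ i, 0 ≤ μ i)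
    (hpar : (∀ i, Even (μ i)) ∨ (∀ i, Odd (μ i))) (hm : μ 0 ≤ m) :
    ∃ p : Polynomial K,
      (RatFunc.X : RatFunc K) ^ m *
          soBD (Fin.cons RatFunc.X fun j => algebraMap K (RatFunc K) (z j)) μ =
        algebraMap (Polynomial K) (RatFunc K) p ∧
      p.eval 0 = if μ 0 = m then soBD z (fun i => μ i.succ) else 0 := by
  obtain ⟨a, ha⟩ : ∃ a : Fin (k + 1) → ℕ,
      ∀ i, (a i : ℤ) = μ i + 2 * (((k + 1 : ℕ) : ℤ) - (i : ℕ)) - 1 := by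
    refine ⟨fun i => (μ i + 2 * (((k + 1 : ℕ) : ℤ) - (i : ℕ)) - 1).toNat, fun i => ?_⟩
    have := hpos i
    have := i.isLt
    exact Int.toNat_of_nonneg (by omega)
  obtain ⟨b, hb⟩ : ∃ b : Fin (k + 1) → ℕ,
      ∀ i, (b i : ℤ) = 2 * (((k + 1 : ℕ) : ℤ) - (i : ℕ)) - 1 := by
    refine ⟨fun i => (2 * (((k + 1 : ℕ) : ℤ) - (i : ℕ)) - 1).toNat, fun i => ?_⟩
    have := i.isLt
    exact Int.toNat_of_nonneg (by omega)
  have ha0 := ha 0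
  have hb0 := hb 0
  simp only [Fin.val_zero] at ha0 hb0
  have hapos : ∀ i, 0 < a i := fun i => by
    have := ha i; have := hpos i; have := i.isLt; omega
  have hbpos : ∀ i, 0 < b i := fun i => by
    have := hb i; have := i.isLt; omega
  have halt : ∀ i : Fin k, a i.succ < a 0 := fun i => by
    have h1 := ha i.succ
    have h2 := hanti (Fin.zero_le i.succ)
    simp only [Fin.val_succ] at h1
    omega
  have hblt : ∀ i : Fin k, b i.succ < b 0 := fun i => by
    have h1 := hb i.succ
    simp only [Fin.val_succ] at h1
    omega
  have hale : ∀ i, a i ≤ a 0 := Fin.cases le_rfl fun i => (halt i).le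
  have hble : ∀ i, b i ≤ b 0 := Fin.cases le_rfl fun i => (hblt i).le
  have hbodd : ∀ i, b i % 2 = 1 := fun i => by have := hb i; omega
  have hapar : ∀ i, a i % 2 = a 0 % 2 := fun i => by
    have h1 := ha i
    rcases hpar with h | h
    · obtain ⟨r, hr⟩ := h i
      obtain ⟨r', hr'⟩ := h 0
      omega
    · obtain ⟨r, hr⟩ := h i
      obtain ⟨r', hr'⟩ := h 0
      omega
  have hden : (altMat z fun l => b l.succ).det ≠ 0 := by
    refine det_altMat_ne_zero hz ?_ ?_ fun i => hbodd _
    · intro i j hij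
      have h1 := hb i.succ
      have h2 := hb j.succ
      simp only [Fin.val_succ] at h1 h2
      simp only at hij
      ext
      omega
    · intro i
      have h1 := hb i.succ
      simp only [Fin.val_succ] at h1
      omega
  set qa := altPoly (a 0) a (altCofactor z a) with hqa
  set qb := altPoly (b 0) b (altCofactor z b) with hqb
  have hqa0 : qa.eval 0 = -(altMat z fun l => a l.succ).det := by
    rw [hqa, eval_zero_altPoly hapos halt, altCofactor_zero]
  have hqb0 : qb.eval 0 = -(altMat z fun l => b l.succ).det := by
    rw [hqb, eval_zero_altPoly hbpos hblt, altCofactor_zero]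
  have hqb_ne : qb ≠ 0 := by
    intro h
    rw [h, Polynomial.eval_zero] at hqb0
    exact hden (neg_eq_zero.mp hqb0.symm)
  have hPa := prod_signedPoint_dvd_altPoly hz hale hapar (altCofactor_vecMul z a)
  have hPb := prod_signedPoint_dvd_altPoly hz hble (ε := 1) hbodd (altCofactor_vecMul z b)
  have hassoc := Polynomial.associated_of_dvd_of_natDegree_le hPb hqb_ne (by
    rw [natDegree_prod_signedPoint]
    have := natDegree_altPoly_le hble (altCofactor z b)
    omega)
  obtain ⟨g, hg⟩ : qb ∣ qa := hassoc.symm.dvd.trans hPa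
  have hXa := X_pow_mul_det_altMat z hale
  have hXb := X_pow_mul_det_altMat z hble
  rw [← hqa] at hXa
  rw [← hqb] at hXb
  obtain ⟨d, hd⟩ : ∃ d : ℕ, m = μ 0 + d := ⟨(m - μ 0).toNat, by omega⟩
  refine ⟨Polynomial.X ^ d * g, ?_, ?_⟩
  · have hX : (RatFunc.X : RatFunc K) ≠ 0 := RatFunc.X_ne_zero
    have hqb_ne' : algebraMap (Polynomial K) (RatFunc K) qb ≠ 0 :=
      RatFunc.algebraMap_ne_zero hqb_ne
    rw [soBD_eq_det_altMat_div _ μ ha hb]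
    set A := (altMat (Fin.cons RatFunc.X fun j => algebraMap K (RatFunc K) (z j) :
      Fin (k + 1) → RatFunc K) a).det
    set B := (altMat (Fin.cons RatFunc.X fun j => algebraMap K (RatFunc K) (z j) :
      Fin (k + 1) → RatFunc K) b).det
    have hB : B ≠ 0 := by
      intro h
      rw [h, mul_zero] at hXb
      exact hqb_ne' hXb.symm
    have hmul : (RatFunc.X : RatFunc K) ^ a 0 * A =
        RatFunc.X ^ b 0 * B * algebraMap (Polynomial K) (RatFunc K) g := by
      rw [hXa, hXb, hg, map_mul]
    have hab : a 0 = (μ 0).toNat + b 0 := by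
      have := hpos 0
      omega
    have hmd : m = (((μ 0).toNat + d : ℕ) : ℤ) := by
      have := hpos 0
      omega
    rw [hab, pow_add] at hmul
    have hmul' : (RatFunc.X : RatFunc K) ^ (μ 0).toNat * A =
        B * algebraMap (Polynomial K) (RatFunc K) g :=
      mul_left_cancel₀ (pow_ne_zero (b 0) hX) (by linear_combination hmul)
    rw [hmd, zpow_natCast, map_mul, map_pow, RatFunc.algebraMap_X, ← mul_div_assoc,
      div_eq_iff hB, pow_add]
    linear_combination RatFunc.X ^ d * hmul'
  · have ha' : ∀ i : Fin k, (a i.succ : ℤ) = μ i.succ + 2 * ((k : ℤ) - (i : ℕ)) - 1 := by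
      intro i
      rw [ha]
      push_cast [Fin.val_succ]
      ring
    have hb' : ∀ i : Fin k, (b i.succ : ℤ) = 2 * ((k : ℤ) - (i : ℕ)) - 1 := by
      intro i
      rw [hb]
      push_cast [Fin.val_succ]
      ring
    rw [soBD_eq_det_altMat_div z (fun i => μ i.succ) ha' hb', Polynomial.eval_mul,
      Polynomial.eval_pow, Polynomial.eval_X]
    split_ifs with h
    · have hd0 : d = 0 := by omega
      rw [hd0, pow_zero, one_mul, eq_div_iff hden]
      have h0 := congrArg (Polynomial.eval 0) hg
      rw [Polynomial.eval_mul, hqa0, hqb0] at h0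
      linear_combination h0
    · rw [zero_pow (by omega), zero_mul]

end Field

theorem generic_gen (N : ℕ) : Generic (gen N) := by
  have hinj := IsFractionRing.injective (MvPolynomial (Fin N) ℚ) (FF N)
  have hev (f : Fin N → ℚ) {p q : MvPolynomial (Fin N) ℚ}
      (h : algebraMap _ (FF N) p = algebraMap _ (FF N) q) :
      MvPolynomial.eval f p = MvPolynomial.eval f q := by rw [hinj h]
  refine ⟨fun i h => ?_, fun i j h => ?_, fun i j h => ?_⟩
  · have := hev (fun _ => 1) (p := MvPolynomial.X i) (q := 0) (by simpa only [gen, map_zero] using h)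
    simp at this
  · by_contra hij
    have := hev (fun l => if l = i then 1 else 0)
      (p := MvPolynomial.X i ^ 2) (q := MvPolynomial.X j ^ 2)
      (by simpa only [gen, map_pow] using h)
    simp [Ne.symm hij] at this
  · have := hev (fun _ => 0) (p := MvPolynomial.X i ^ 2 * MvPolynomial.X j ^ 2) (q := 1)
      (by simpa only [gen, map_pow, map_mul, map_one] using h)
    simp at this

/-- **Lemma (reduction lemma, part (2), odd orthogonal case).**  Let `n ≥ 1`, `m = m2/2` a
nonnegative half-integer, and `λ = μ/2` a partition or half-partition (all parts integers, or
all parts in `ℕ + 1/2`) with `λ_1 ≤ m`.  Viewing the odd orthogonal character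
`so^B_λ(x_1, …, x_n)` as a rational function of `t = x_1^{1/2}` over the field
`ℚ(x_2^{1/2}, …, x_n^{1/2})`, the product `x_1^m · so^B_λ` is a polynomial in `t`, whose value
at `t = 0` is `so^B_{(λ_2,…,λ_n)}(x_2, …, x_n)` if `λ_1 = m` and is `0` if `λ_1 < m`.  Here the
base field is `FF (n-1)` (with `gen (n-1) i` playing the role of `x_{i+2}^{1/2}`), `RatFunc.X`
plays the role of `t = x_1^{1/2}` (so `x_1^m = t^{m2}`), and all weights are doubled. -/
theorem soB_mul_pow_eq_polynomial_and_eval_zero (n : ℕ) (hn : 0 < n) (m2 : ℤ) (hm : 0 ≤ m2)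
    (μ : Fin n → ℤ) (hanti : Antitone μ) (hpos : ∀ i, 0 ≤ μ i)
    (hpar : (∀ i, Even (μ i)) ∨ (∀ i, Odd (μ i))) (hlam : μ ⟨0, hn⟩ ≤ m2) :
    ∃ p : Polynomial (FF (n - 1)),
      (RatFunc.X : RatFunc (FF (n - 1))) ^ m2 *
          soBD
            (fun j : Fin n =>
              if h : (j : ℕ) = 0 then RatFunc.X
              else
                algebraMap (FF (n - 1)) (RatFunc (FF (n - 1)))
                  (gen (n - 1) ⟨(j : ℕ) - 1, by have := j.isLt; omega⟩))
            μ =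
        algebraMap (Polynomial (FF (n - 1))) (RatFunc (FF (n - 1))) p ∧
      p.eval 0 =
        if μ ⟨0, hn⟩ = m2 then
          soBD (gen (n - 1))
            (fun i : Fin (n - 1) => μ ⟨(i : ℕ) + 1, by have := i.isLt; omega⟩)
        else 0 := by
  obtain ⟨k, rfl⟩ : ∃ k, n = k + 1 := ⟨n - 1, by omega⟩
  have : CharZero (FF k) := algebraRat.charZero _
  obtain ⟨p, hp, hp0⟩ := exists_polynomial_X_zpow_mul_soBD (generic_gen k) hanti hpos hpar hlam
  refine ⟨p, ?_, hp0⟩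
  refine Eq.trans ?_ hp
  congr 2
  funext j
  refine Fin.cases ?_ (fun j => ?_) j
  · simp
  · simp
end
end
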